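/- arXiv:2404.08475 — 3 statements merged into one kernel-verified Lean document; each statement's English description precedes it below -/
import Mathlib

section
/- A mapping ρ : 𝒳 × 𝒴 → ℝ satisfies conditions M, AD, IC, N and LI if and only if there exists a law-invariant family of probability measures {Q_W : W ∈ 𝒴} on (ℝ^N, 𝓑(ℝ^N)) with Q_W absolutely continuous with respect to ℙ∘W⁻¹ such that ρ(X, W) = ∫_{ℝ^N} 𝔼(X | W = w) dQ_W(w) for all X ∈ 𝒳 and W ∈ 𝒴, where 𝔼(X | W = ·) is a Borel measurable version of the conditional expectation of X given W (the integral does not depend on the chosen version because Q_W ≪ ℙ∘W⁻¹). -/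
open MeasureTheory ProbabilityTheory Set Filter

noncomputable section

/-- The probability measure `P` is atomless. -/
def Atomless {Ω : Type*} [MeasurableSpace Ω] (P : Measure Ω) : Prop :=
  ∀ A : Set Ω, MeasurableSet A → 0 < P A →
    ∃ B, B ⊆ A ∧ MeasurableSet B ∧ 0 < P B ∧ P B < P A

/-- A bounded (measurable) random variable, i.e. a member of `𝒳 = L^∞`. -/
def BddRV {Ω : Type*} [MeasurableSpace Ω] (X : Ω → ℝ) : Prop :=
  Measurable X ∧ ∃ C : ℝ, ∀ ω, |X ω| ≤ C

/-- Two random variables are comonotonic. -/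
def Comonotonic {Ω : Type*} (X₁ X₂ : Ω → ℝ) : Prop :=
  ∃ (Z : Ω → ℝ) (f₁ f₂ : ℝ → ℝ), Monotone f₁ ∧ Monotone f₂ ∧
    (∀ x, f₁ x + f₂ x = x) ∧ (∀ ω, X₁ ω = f₁ (Z ω)) ∧ (∀ ω, X₂ ω = f₂ (Z ω))

/-- `K` is a Markov-kernel version of the conditional distribution of `X` given `W`. -/
def IsCondDistrib {Ω : Type*} [MeasurableSpace Ω] {N : ℕ} (P : Measure Ω)
    (X : Ω → ℝ) (W : Ω → (Fin N → ℝ)) (K : Kernel (Fin N → ℝ) ℝ) : Prop :=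
  IsMarkovKernel K ∧
    ∀ B : Set ℝ, MeasurableSet B → ∀ S : Set (Fin N → ℝ), MeasurableSet S →
      P ({ω | X ω ∈ B} ∩ W ⁻¹' S) = ∫⁻ w in S, K w B ∂(P.map W)

/-- Membership in `D*`: Borel measurable functions `ℝ^N → [0,1]`. -/
def InDstar {N : ℕ} (f : (Fin N → ℝ) → ℝ) : Prop :=
  Measurable f ∧ ∀ w, f w ∈ Icc (0:ℝ) 1

/-- `g` is a Borel measurable version of the conditional expectation `E(X | W = ·)`. -/
def IsCondExpVersion {Ω : Type*} [MeasurableSpace Ω] {N : ℕ} (P : Measure Ω)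
    (X : Ω → ℝ) (W : Ω → (Fin N → ℝ)) (g : (Fin N → ℝ) → ℝ) : Prop :=
  Measurable g ∧ ∀ S : Set (Fin N → ℝ), MeasurableSet S →
    ∫ ω in W ⁻¹' S, X ω ∂P = ∫ w in S, g w ∂(P.map W)

lemma atomless_small {Ω : Type*} [MeasurableSpace Ω] (P : Measure Ω) [IsProbabilityMeasure P]
    (h : Atomless P) (A : Set Ω) (hA : MeasurableSet A) (hpos : 0 < P A) (n : ℕ) :
    ∃ B, B ⊆ A ∧ MeasurableSet B ∧ 0 < P B ∧ P B ≤ (2⁻¹ : ENNReal) ^ n := by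
  induction n with
  | zero => exact ⟨A, subset_rfl, hA, hpos, by simpa using prob_le_one⟩
  | succ n ih =>
    obtain ⟨B, hBA, hB, hBpos, hBle⟩ := ih
    obtain ⟨C, hCB, hC, hCpos, hClt⟩ := h B hB hBpos
    have hsum : P C + P (B \ C) = P B := by
      rw [← measure_inter_add_sdiff B hC, inter_eq_right.mpr hCB]
    by_cases hc : P C ≤ (2⁻¹ : ENNReal) ^ (n+1)
    · exact ⟨C, hCB.trans hBA, hC, hCpos, hc⟩
    · refine ⟨B \ C, sdiff_subset.trans hBA, hB.diff hC, ?_, ?_⟩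
      · by_contra hz
        have : P (B \ C) = 0 := by simpa using hz
        rw [this, add_zero] at hsum
        exact hClt.ne hsum
      · by_contra hz
        push Not at hc hz
        have h1 : (2⁻¹ : ENNReal) ^ (n+1) + (2⁻¹ : ENNReal) ^ (n+1) < P C + P (B \ C) :=
          ENNReal.add_lt_add hc hz
        have h2 : (2⁻¹ : ENNReal) ^ (n+1) + (2⁻¹ : ENNReal) ^ (n+1) = (2⁻¹ : ENNReal) ^ n := by
          rw [pow_succ, ← mul_add, ENNReal.inv_two_add_inv_two, mul_one]
        rw [h2, hsum] at h1
        exact absurd hBle (not_le.mpr h1)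

lemma atomless_cover {Ω : Type*} [MeasurableSpace Ω] (P : Measure Ω) [IsProbabilityMeasure P]
    (h : Atomless P) (n : ℕ) :
    ∃ C : ℕ → Set Ω, (∀ k, MeasurableSet (C k)) ∧ (∀ k, P (C k) ≤ (2⁻¹ : ENNReal) ^ n) ∧
      P (⋃ k, C k)ᶜ = 0 := by
  let K : Set (Set Ω) := {S | ∃ C : ℕ → Set Ω, (∀ k, MeasurableSet (C k)) ∧
    (∀ k, P (C k) ≤ (2⁻¹ : ENNReal) ^ n) ∧ S = ⋃ k, C k}
  have hne : (P '' K).Nonempty := ⟨_, _, ⟨fun _ => ∅, by simp, by simp, rfl⟩, rfl⟩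
  obtain ⟨u, -, hu, huK⟩ := exists_seq_tendsto_sSup hne (OrderTop.bddAbove _)
  choose S hSK hSu using huK
  choose C hCm hCle hSC using hSK
  let e := Nat.pairEquiv.symm
  have hT : (⋃ m, S m) ∈ K := by
    refine ⟨fun k => C (e k).1 (e k).2, fun k => hCm _ _, fun k => hCle _ _, ?_⟩
    ext x
    simp only [mem_iUnion, hSC]
    constructor
    · rintro ⟨i, j, hx⟩
      exact ⟨e.symm (i, j), by simpa using hx⟩
    · rintro ⟨k, hx⟩
      exact ⟨_, _, hx⟩
  have hPT : sSup (P '' K) ≤ P (⋃ m, S m) :=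
    le_of_tendsto' hu fun m => by rw [← hSu]; exact measure_mono (subset_iUnion _ _)
  obtain ⟨D, hDm, hDle, hTD⟩ := hT
  refine ⟨D, hDm, hDle, ?_⟩
  by_contra hz
  have hDU : MeasurableSet (⋃ k, D k) := MeasurableSet.iUnion hDm
  obtain ⟨B, hB, hBm, hBpos, hBle⟩ := atomless_small P h _ hDU.compl (pos_iff_ne_zero.mpr hz) n
  have hmem : (⋃ k, D k) ∪ B ∈ K := by
    refine ⟨fun k => Nat.casesOn k B D, ?_, ?_, ?_⟩
    · rintro (_|k); exacts [hBm, hDm k]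
    · rintro (_|k); exacts [hBle, hDle k]
    · ext x
      simp only [mem_union, mem_iUnion]
      constructor
      · rintro (⟨k, hk⟩ | hx)
        exacts [⟨k+1, hk⟩, ⟨0, hx⟩]
      · rintro ⟨_|k, hk⟩
        exacts [Or.inr hk, Or.inl ⟨k, hk⟩]
  have h1 : P ((⋃ k, D k) ∪ B) ≤ P (⋃ k, D k) := by
    refine le_trans ?_ (hTD ▸ le_rfl : P (⋃ m, S m) ≤ P (⋃ k, D k))
    exact (le_sSup (mem_image_of_mem P hmem)).trans hPT
  rw [measure_union (disjoint_left.mpr fun x hx hb => hB hb hx) hBm] at h1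
  exact absurd h1 (not_le.mpr (ENNReal.lt_add_right (measure_ne_top _ _) hBpos.ne'))

lemma exists_real_noatom {Ω : Type*} [MeasurableSpace Ω] (P : Measure Ω) [IsProbabilityMeasure P]
    (h : Atomless P) : ∃ Y : Ω → ℝ, Measurable Y ∧ ∀ y, P.map Y {y} = 0 := by
  classical
  choose C hCm hCle hC0 using atomless_cover P h
  let Y : Ω → (ℕ × ℕ → Bool) := fun ω p => decide (ω ∈ C p.1 p.2)
  have hY : Measurable Y := by
    refine measurable_pi_lambda _ fun p => ?_
    refine measurable_to_bool ?_
    have : (fun ω => Y ω p) ⁻¹' {true} = C p.1 p.2 := by ext; simp [Y]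
    rw [this]; exact hCm _ _
  have hemb := measurableEmbedding_embeddingReal (ℕ × ℕ → Bool)
  refine ⟨fun ω => embeddingReal _ (Y ω), hemb.measurable.comp hY, fun y => ?_⟩
  have hm : Measurable (fun ω => embeddingReal _ (Y ω)) := hemb.measurable.comp hY
  rw [Measure.map_apply hm (measurableSet_singleton y)]
  set E := (fun ω => embeddingReal _ (Y ω)) ⁻¹' {y} with hE
  have hle : ∀ n, P E ≤ (2⁻¹ : ENNReal) ^ n := by
    intro n
    by_cases hex : ∃ ω ∈ E, ω ∈ ⋃ k, C n k
    · obtain ⟨ω, hω, hk⟩ := hex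
      obtain ⟨k, hk⟩ := mem_iUnion.mp hk
      refine (measure_mono ?_).trans (hCle n k)
      intro ω' hω'
      have : Y ω' = Y ω := hemb.injective (hω'.trans hω.symm)
      have := congrFun this (n, k)
      simpa [Y, hk] using this
    · push Not at hex
      have : P E ≤ P (⋃ k, C n k)ᶜ := measure_mono hex
      rw [hC0] at this
      exact this.trans zero_le
  have ht : Tendsto (fun n : ℕ => (2⁻¹ : ENNReal) ^ n) atTop (nhds 0) :=
    ENNReal.tendsto_pow_atTop_nhds_zero_of_lt_one (by simp)
  exact le_antisymm (ge_of_tendsto' ht hle) zero_le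

lemma exists_uniform {Ω : Type*} [MeasurableSpace Ω] (P : Measure Ω) [IsProbabilityMeasure P]
    (h : Atomless P) : ∃ U : Ω → unitInterval, Measurable U ∧ P.map U = volume := by
  obtain ⟨Y, hY, hY0⟩ := exists_real_noatom P h
  set ν := P.map Y with hν
  have : IsProbabilityMeasure ν := Measure.isProbabilityMeasure_map hY.aemeasurable
  have hcont : Continuous (cdf ν) := by
    rw [continuous_iff_continuousAt]
    intro x
    rw [(monotone_cdf ν).continuousAt_iff_leftLim_eq_rightLim, StieltjesFunction.rightLim_eq]
    have h1 := StieltjesFunction.measure_singleton (cdf ν) x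
    rw [measure_cdf, hY0] at h1
    have h2 := ENNReal.ofReal_eq_zero.mp h1.symm
    exact le_antisymm ((monotone_cdf ν).leftLim_le le_rfl) (by linarith)
  have hFm : Measurable (cdf ν) := hcont.measurable
  have key : ∀ t, 0 < t → t < 1 → ∃ x, cdf ν x = t := by
    intro t h0 h1
    have ha := ((tendsto_cdf_atBot ν).eventually_lt_const h0).exists
    have hb := ((tendsto_cdf_atTop ν).eventually_const_lt h1).exists
    obtain ⟨a, ha⟩ := ha
    obtain ⟨b, hb⟩ := hb
    exact mem_range_of_exists_le_of_exists_ge hcont ⟨a, ha.le⟩ ⟨b, hb.le⟩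
  have hlt : ∀ t : ℝ, 0 < t → ν {x | cdf ν x < t} ≤ ENNReal.ofReal t := by
    intro t h0
    by_cases h1 : t < 1
    · obtain ⟨x, hx⟩ := key t h0 h1
      rw [← hx, ofReal_cdf]
      refine measure_mono fun y hy => ?_
      by_contra hxy
      exact absurd (monotone_cdf ν (le_of_not_ge hxy)) (not_le.mpr hy)
    · exact prob_le_one.trans (by rw [← ENNReal.ofReal_one]; exact ENNReal.ofReal_le_ofReal (not_lt.mp h1))
  have hle : ∀ t : ℝ, t ≤ 1 → ENNReal.ofReal t ≤ ν {x | cdf ν x ≤ t} := by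
    intro t h1
    rcases le_or_gt t 0 with h0 | h0
    · rw [ENNReal.ofReal_of_nonpos h0]; exact zero_le
    rcases h1.eq_or_lt with rfl | h1
    · simp [cdf_le_one]
    · obtain ⟨x, hx⟩ := key t h0 h1
      rw [← hx, ofReal_cdf]
      exact measure_mono fun y hy => monotone_cdf ν hy
  have heq : ∀ t : ℝ, 0 ≤ t → t ≤ 1 → ν {x | cdf ν x ≤ t} = ENNReal.ofReal t := by
    intro t h0 h1
    refine le_antisymm ?_ (hle t h1)
    have ht : Tendsto (fun s => ENNReal.ofReal s) (nhdsWithin t (Ioi t)) (nhds (ENNReal.ofReal t)) :=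
      (ENNReal.continuous_ofReal.tendsto t).mono_left nhdsWithin_le_nhds
    refine ge_of_tendsto ht ?_
    filter_upwards [self_mem_nhdsWithin] with s hs
    refine (measure_mono ?_).trans (hlt s (h0.trans_lt hs))
    intro x hx
    exact lt_of_le_of_lt hx (mem_Ioi.mp hs)
  let U : Ω → unitInterval := fun ω => ⟨cdf ν (Y ω), cdf_nonneg _ _, cdf_le_one _ _⟩
  have hU : Measurable U := (hFm.comp hY).subtype_mk
  refine ⟨U, hU, ?_⟩
  have : IsProbabilityMeasure (P.map U) := Measure.isProbabilityMeasure_map hU.aemeasurable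
  refine Measure.ext_of_Iic _ _ fun a => ?_
  rw [unitInterval.volume_Iic, Measure.map_apply hU measurableSet_Iic, ← heq a a.2.1 a.2.2, hν,
    Measure.map_apply hY (measurableSet_le hFm measurable_const)]
  rfl

lemma exists_law {Ω : Type*} [MeasurableSpace Ω] (P : Measure Ω) [IsProbabilityMeasure P]
    (h : Atomless P) {E : Type*} [MeasurableSpace E] [StandardBorelSpace E] 
    (π : Measure E) [IsProbabilityMeasure π] : ∃ f : Ω → E, Measurable f ∧ P.map f = π := by
  obtain ⟨U, hU, hUv⟩ := exists_uniform P h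
  have : Nonempty E := π.nonempty_of_neZero
  obtain ⟨f, hf, hfπ⟩ := π.exists_measurable_map_eq
  exact ⟨f ∘ U, hf.comp hU, by rw [← Measure.map_map hf hU, hUv, hfπ]⟩

lemma exists_circle_coord : ∃ c : UnitAddCircle → ℝ, Measurable c ∧
    ∀ t ∈ Icc (0:ℝ) 1, volume {v | c v ≤ t} = ENNReal.ofReal t := by
  let c : UnitAddCircle → ℝ := fun v => (AddCircle.measurableEquivIoc 1 0 v : ℝ)
  have hc : Measurable c := measurable_subtype_coe.comp (AddCircle.measurableEquivIoc 1 0).measurable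
  refine ⟨c, hc, fun t ht => ?_⟩
  have hm : MeasurableSet {v | c v ≤ t} := measurableSet_le hc measurable_const
  have mp := AddCircle.measurePreserving_mk 1 0
  rw [← mp.measure_preimage hm.nullMeasurableSet, Measure.restrict_apply (mp.measurable hm)]
  have : (QuotientAddGroup.mk ⁻¹' {v : UnitAddCircle | c v ≤ t} ∩ Ioc (0:ℝ) (0+1)) = Ioc 0 t := by
    ext x
    simp only [mem_inter_iff, mem_preimage, mem_ofPred_eq, mem_Ioc]
    have hx : ∀ hx : x ∈ Ioc (0:ℝ) (0+1), c (QuotientAddGroup.mk x) = x := by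
      intro hx
      have := (AddCircle.equivIoc (1:ℝ) 0).apply_symm_apply ⟨x, hx⟩
      exact congrArg Subtype.val this
    constructor
    · rintro ⟨h1, h2⟩
      rw [hx h2] at h1
      exact ⟨h2.1, h1⟩
    · rintro ⟨h1, h2⟩
      have h3 : x ∈ Ioc (0:ℝ) (0+1) := ⟨h1, by linarith [ht.2]⟩
      exact ⟨by rw [hx h3]; exact h2, h3⟩
  rw [this, Real.volume_Ioc, sub_zero]

lemma BddRV.integrable' {Ω : Type*} [MeasurableSpace Ω] {P : Measure Ω} [IsFiniteMeasure P]
    {X : Ω → ℝ} (hX : BddRV X) : Integrable X P := by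
  obtain ⟨hm, C, hC⟩ := hX
  exact Integrable.of_bound hm.aestronglyMeasurable C (Eventually.of_forall hC)

lemma exists_version {Ω : Type*} [MeasurableSpace Ω] (P : Measure Ω) [IsProbabilityMeasure P]
    {N : ℕ} (X : Ω → ℝ) (W : Ω → (Fin N → ℝ)) (hX : BddRV X) (hW : Measurable W) :
    ∃ g : (Fin N → ℝ) → ℝ, IsCondExpVersion P X W g ∧ Integrable g (P.map W) ∧
      g ∘ W = P[X | MeasurableSpace.comap W inferInstance] := by
  have hsm : StronglyMeasurable[MeasurableSpace.comap W inferInstance]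
    (P[X | MeasurableSpace.comap W inferInstance]) := stronglyMeasurable_condExp
  obtain ⟨g, hg, hgW⟩ := hsm.measurable.exists_eq_measurable_comp
  have hle : MeasurableSpace.comap W inferInstance ≤ (inferInstance : MeasurableSpace Ω) :=
    hW.comap_le
  refine ⟨g, ⟨hg, fun S hS => ?_⟩, ?_, hgW.symm⟩
  · rw [setIntegral_map hS hg.aestronglyMeasurable hW.aemeasurable,
      ← setIntegral_condExp hle hX.integrable' ⟨S, hS, rfl⟩, hgW]
    rfl
  · rw [integrable_map_measure hg.aestronglyMeasurable hW.aemeasurable, ← hgW]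
    exact integrable_condExp

lemma version_unique {Ω : Type*} [MeasurableSpace Ω] (P : Measure Ω) [IsProbabilityMeasure P]
    {N : ℕ} (X : Ω → ℝ) (W : Ω → (Fin N → ℝ)) (hW : Measurable W)
    (g g' : (Fin N → ℝ) → ℝ) (hg : IsCondExpVersion P X W g) (hgi : Integrable g (P.map W))
    (hg' : IsCondExpVersion P X W g') : g =ᵐ[P.map W] g' := by
  have : IsProbabilityMeasure (P.map W) := Measure.isProbabilityMeasure_map hW.aemeasurable
  have hS : ∀ n : ℕ, MeasurableSet {w | |g' w| ≤ n} := fun n =>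
    measurableSet_le (hg'.1.abs) measurable_const
  have h1 : ∀ n : ℕ, ∀ᵐ w ∂(P.map W), w ∈ {w | |g' w| ≤ n} → g w = g' w := by
    intro n
    rw [← ae_restrict_iff' (hS n)]
    refine Integrable.ae_eq_of_forall_setIntegral_eq _ _ hgi.restrict ?_ ?_
    · refine Integrable.of_bound hg'.1.aestronglyMeasurable n ?_
      rw [ae_restrict_iff' (hS n)]
      exact Eventually.of_forall fun w hw => hw
    · intro s hs _
      rw [Measure.restrict_restrict hs, ← hg.2 _ (hs.inter (hS n)), ← hg'.2 _ (hs.inter (hS n))]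
  filter_upwards [ae_all_iff.mpr h1] with w hw
  obtain ⟨n, hn⟩ := exists_nat_ge |g' w|
  exact hw n hn

lemma pull_out {Ω : Type*} [MeasurableSpace Ω] (P : Measure Ω) [IsProbabilityMeasure P]
    {N : ℕ} (X : Ω → ℝ) (W : Ω → (Fin N → ℝ)) (hX : BddRV X) (hW : Measurable W)
    (g : (Fin N → ℝ) → ℝ) (hg : IsCondExpVersion P X W g)
    (f : (Fin N → ℝ) → ℝ) (hf : Measurable f) (hfi : Integrable f (P.map W)) :
    ∫ ω, X ω * f (W ω) ∂P = ∫ w, g w * f w ∂(P.map W) := by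
  obtain ⟨g₀, hg₀, hg₀i, hg₀W⟩ := exists_version P X W hX hW
  have hae := version_unique P X W hW g₀ g hg₀ hg₀i hg
  have hle : MeasurableSpace.comap W inferInstance ≤ (inferInstance : MeasurableSpace Ω) :=
    hW.comap_le
  have h1 : ∫ w, g w * f w ∂(P.map W) = ∫ w, g₀ w * f w ∂(P.map W) :=
    integral_congr_ae (by filter_upwards [hae] with w hw; rw [hw])
  have hm : Measurable (fun w => g₀ w * f w) := hg₀.1.mul hf
  rw [h1, integral_map hW.aemeasurable hm.aestronglyMeasurable]
  have hfW : Integrable (f ∘ W) P :=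
    (integrable_map_measure hf.aestronglyMeasurable hW.aemeasurable).mp hfi
  obtain ⟨C, hC⟩ := hX.2
  have hprod : Integrable (X * (f ∘ W)) P :=
    hfW.bdd_mul hX.1.aestronglyMeasurable (Eventually.of_forall hC)
  have hsm : StronglyMeasurable[MeasurableSpace.comap W inferInstance] (f ∘ W) :=
    (hf.comp (comap_measurable W)).stronglyMeasurable
  have h2 := condExp_mul_of_stronglyMeasurable_right hsm hprod hX.integrable'
  have h3 := integral_condExp (f := X * (f ∘ W)) (μ := P) hle
  rw [integral_congr_ae h2, ← hg₀W] at h3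
  exact h3.symm

lemma version_rep {Ω : Type*} [MeasurableSpace Ω] (P : Measure Ω) [IsProbabilityMeasure P]
    {N : ℕ} (X : Ω → ℝ) (W : Ω → (Fin N → ℝ)) (hX : BddRV X) (hW : Measurable W)
    (g : (Fin N → ℝ) → ℝ) (hg : IsCondExpVersion P X W g)
    (Q : Measure (Fin N → ℝ)) [IsProbabilityMeasure Q] (hQ : Q ≪ P.map W) :
    ∫ w, g w ∂Q = ∫ ω, X ω * (Q.rnDeriv (P.map W) (W ω)).toReal ∂P := by
  have : IsProbabilityMeasure (P.map W) := Measure.isProbabilityMeasure_map hW.aemeasurable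
  have hd : Q.HaveLebesgueDecomposition (P.map W) :=
    Measure.haveLebesgueDecomposition_of_sigmaFinite _ _
  rw [← integral_rnDeriv_smul hQ]
  rw [pull_out P X W hX hW g hg (fun w => (Q.rnDeriv (P.map W) w).toReal)
    (Measure.measurable_rnDeriv _ _).ennreal_toReal Measure.integrable_toReal_rnDeriv]
  simp only [smul_eq_mul, mul_comm]

lemma integrable_dens {Ω : Type*} [MeasurableSpace Ω] (P : Measure Ω) [IsProbabilityMeasure P]
    {N : ℕ} (X : Ω → ℝ) (W : Ω → (Fin N → ℝ)) (hX : BddRV X) (hW : Measurable W)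
    (Q : Measure (Fin N → ℝ)) [IsProbabilityMeasure Q] :
    Integrable (fun ω => X ω * (Q.rnDeriv (P.map W) (W ω)).toReal) P := by
  obtain ⟨C, hC⟩ := hX.2
  refine Integrable.bdd_mul ?_ hX.1.aestronglyMeasurable (Eventually.of_forall hC)
  exact (integrable_map_measure (Measure.measurable_rnDeriv _ _).ennreal_toReal.aestronglyMeasurable
    hW.aemeasurable).mp Measure.integrable_toReal_rnDeriv

lemma bddRV_indicator {Ω : Type*} [MeasurableSpace Ω] {A : Set Ω} (hA : MeasurableSet A) :
    BddRV (A.indicator fun _ => (1:ℝ)) :=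
  ⟨measurable_const.indicator hA, 1, fun ω => by by_cases h : ω ∈ A <;> simp [h]⟩

lemma bddRV_const {Ω : Type*} [MeasurableSpace Ω] (c : ℝ) : BddRV (fun _ : Ω => c) :=
  ⟨measurable_const, |c|, fun _ => le_rfl⟩

lemma BddRV.add' {Ω : Type*} [MeasurableSpace Ω] {X Y : Ω → ℝ} (hX : BddRV X) (hY : BddRV Y) :
    BddRV (X + Y) := by
  obtain ⟨hX, C, hC⟩ := hX
  obtain ⟨hY, D, hD⟩ := hY
  exact ⟨hX.add hY, C + D, fun ω => (abs_add_le _ _).trans (add_le_add (hC ω) (hD ω))⟩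

lemma backward {Ω : Type*} [MeasurableSpace Ω] (P : Measure Ω) [IsProbabilityMeasure P]
    {N : ℕ} (ρ : (Ω → ℝ) → (Ω → (Fin N → ℝ)) → ℝ)
    (Q : (Ω → (Fin N → ℝ)) → Measure (Fin N → ℝ))
    (hQ : ∀ W : Ω → (Fin N → ℝ), Measurable W → IsProbabilityMeasure (Q W) ∧ Q W ≪ P.map W)
    (hQL : ∀ W W' : Ω → (Fin N → ℝ), Measurable W → Measurable W' →
        P.map W = P.map W' → Q W = Q W')
    (hr : ∀ X W, BddRV X → Measurable W →
        ∀ g : (Fin N → ℝ) → ℝ, IsCondExpVersion P X W g → ρ X W = ∫ w, g w ∂(Q W)) :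
    ((∀ X Y W, BddRV X → BddRV Y → Measurable W → (∀ᵐ ω ∂P, X ω ≤ Y ω) → ρ X W ≤ ρ Y W) ∧
     (∀ X Y W, BddRV X → BddRV Y → Measurable W → ρ (X + Y) W = ρ X W + ρ Y W) ∧
     (∀ (A : ℕ → Set Ω) (Alim : Set Ω), (∀ n, MeasurableSet (A n)) → Monotone A →
        Alim = ⋃ n, A n → ∀ W : Ω → (Fin N → ℝ), Measurable W →
        ρ (Alim.indicator fun _ => 1) W ≤
          liminf (fun n => ρ ((A n).indicator fun _ => 1) W) atTop) ∧
     (∀ W : Ω → (Fin N → ℝ), Measurable W → ρ (fun _ => 1) W = 1) ∧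
     (∀ X X' W W', BddRV X → BddRV X' → Measurable W → Measurable W' →
        (P.map fun ω => (X ω, W ω)) = (P.map fun ω => (X' ω, W' ω)) → ρ X W = ρ X' W')) := by
  have rep : ∀ X W, BddRV X → Measurable W →
      ρ X W = ∫ ω, X ω * ((Q W).rnDeriv (P.map W) (W ω)).toReal ∂P := by
    intro X W hX hW
    obtain ⟨g, hg, -⟩ := exists_version P X W hX hW
    have := (hQ W hW).1
    rw [hr X W hX hW g hg, version_rep P X W hX hW g hg _ (hQ W hW).2]
  refine ⟨?_, ?_, ?_, ?_, ?_⟩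
  · intro X Y W hX hY hW hle
    have := (hQ W hW).1
    rw [rep X W hX hW, rep Y W hY hW]
    refine integral_mono_ae (integrable_dens P X W hX hW _) (integrable_dens P Y W hY hW _) ?_
    filter_upwards [hle] with ω hω
    exact mul_le_mul_of_nonneg_right hω ENNReal.toReal_nonneg
  · intro X Y W hX hY hW
    have := (hQ W hW).1
    rw [rep X W hX hW, rep Y W hY hW, rep _ W (hX.add' hY) hW,
      ← integral_add (integrable_dens P X W hX hW _) (integrable_dens P Y W hY hW _)]
    simp only [Pi.add_apply, add_mul]
  · intro A Alim hA hmono hlim W hW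
    have := (hQ W hW).1
    have hAl : MeasurableSet Alim := hlim ▸ MeasurableSet.iUnion hA
    have ht : Tendsto (fun n => ρ ((A n).indicator fun _ => 1) W) atTop
        (nhds (ρ (Alim.indicator fun _ => 1) W)) := by
      rw [rep _ W (bddRV_indicator hAl) hW]
      simp_rw [fun n => rep _ W (bddRV_indicator (hA n)) hW]
      refine tendsto_integral_of_dominated_convergence
        (fun ω => 1 * ((Q W).rnDeriv (P.map W) (W ω)).toReal) ?_ ?_ ?_ ?_
      · exact fun n => (integrable_dens P _ W (bddRV_indicator (hA n)) hW _).aestronglyMeasurable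
      · exact integrable_dens P (fun _ => 1) W (bddRV_const 1) hW _
      · refine fun n => Eventually.of_forall fun ω => ?_
        rw [norm_mul, Real.norm_of_nonneg ENNReal.toReal_nonneg]
        refine mul_le_mul_of_nonneg_right ?_ ENNReal.toReal_nonneg
        by_cases h : ω ∈ A n <;> simp [h]
      · refine Eventually.of_forall fun ω => Tendsto.mul_const _ ?_
        rw [hlim]
        refine tendsto_const_nhds.congr' ?_
        by_cases hω : ω ∈ ⋃ n, A n
        · obtain ⟨n, hn⟩ := mem_iUnion.mp hω
          filter_upwards [eventually_ge_atTop n] with m hm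
          rw [indicator_of_mem hω, indicator_of_mem (hmono hm hn)]
        · refine Eventually.of_forall fun m => ?_
          have hm : ω ∉ A m := fun h => hω (mem_iUnion.mpr ⟨m, h⟩)
          simp only [indicator_of_notMem hω, indicator_of_notMem hm]
    rw [ht.liminf_eq]
  · intro W hW
    have := (hQ W hW).1
    rw [hr (fun _ => 1) W (bddRV_const 1) hW (fun _ => 1) ⟨measurable_const, fun S hS => ?_⟩]
    · simp
    · simp [measureReal_def, Measure.map_apply hW hS]
  · intro X X' W W' hX hX' hW hW' heq
    have hWW : P.map W = P.map W' := by
      have := congrArg (Measure.map Prod.snd) heq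
      rwa [Measure.map_map measurable_snd (hX.1.prodMk hW),
        Measure.map_map measurable_snd (hX'.1.prodMk hW')] at this
    obtain ⟨g, hg, -⟩ := exists_version P X W hX hW
    rw [hr X W hX hW g hg, hQL W W' hW hW' hWW]
    refine (hr X' W' hX' hW' g ⟨hg.1, fun S hS => ?_⟩).symm
    rw [← hWW, ← hg.2 S hS]
    have gen : ∀ (X : Ω → ℝ) (W : Ω → (Fin N → ℝ)), BddRV X → Measurable W →
        ∫ ω in W ⁻¹' S, X ω ∂P = ∫ z in Prod.snd ⁻¹' S, z.1 ∂(P.map fun ω => (X ω, W ω)) := by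
      intro X W hX hW
      rw [setIntegral_map (measurable_snd hS) measurable_fst.aestronglyMeasurable
        (hX.1.prodMk hW).aemeasurable]
      rfl
    rw [gen X' W' hX' hW', gen X W hX hW, heq]

lemma functional_rep {Ω : Type*} [MeasurableSpace Ω] (P : Measure Ω)
    (L : (Ω → ℝ) → ℝ)
    (hM : ∀ X Y, BddRV X → BddRV Y → (∀ᵐ ω ∂P, X ω ≤ Y ω) → L X ≤ L Y)
    (hAD : ∀ X Y, BddRV X → BddRV Y → L (X + Y) = L X + L Y)
    (hIC : ∀ (A : ℕ → Set Ω) (Alim : Set Ω), (∀ n, MeasurableSet (A n)) → Monotone A →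
        Alim = ⋃ n, A n →
        L (Alim.indicator fun _ => 1) ≤ liminf (fun n => L ((A n).indicator fun _ => 1)) atTop)
    (hN : L (fun _ => 1) = 1) :
    ∃ μ : Measure Ω, IsProbabilityMeasure μ ∧
      (∀ A, MeasurableSet A → μ A = ENNReal.ofReal (L (A.indicator fun _ => 1))) ∧
      ∀ X, BddRV X → L X = ∫ ω, X ω ∂μ := by
  have h0 : L (fun _ => 0) = 0 := by
    have := hAD (fun _ => 0) (fun _ => 0) (bddRV_const 0) (bddRV_const 0)
    have e : ((fun _ => 0 : Ω → ℝ) + fun _ => 0) = fun _ => 0 := by ext; simp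
    rw [e] at this
    linarith
  have hpos : ∀ A, MeasurableSet A → 0 ≤ L (A.indicator fun _ => 1) := by
    intro A hA
    rw [← h0]
    exact hM _ _ (bddRV_const 0) (bddRV_indicator hA)
      (Eventually.of_forall fun ω => indicator_nonneg (fun _ _ => zero_le_one) ω)
  have hbsum : ∀ (Z : ℕ → Ω → ℝ), (∀ i, BddRV (Z i)) → ∀ n,
      BddRV (∑ i ∈ Finset.range n, Z i) ∧
      L (∑ i ∈ Finset.range n, Z i) = ∑ i ∈ Finset.range n, L (Z i) := by
    intro Z hZ n
    induction n with
    | zero => exact ⟨bddRV_const 0, h0⟩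
    | succ n ih =>
      rw [Finset.sum_range_succ, Finset.sum_range_succ]
      exact ⟨ih.1.add' (hZ n), by rw [hAD _ _ ih.1 (hZ n), ih.2]⟩
  have hempty : L ((∅ : Set Ω).indicator fun _ => 1) = 0 := by
    rw [indicator_empty]; exact h0
  let μ : Measure Ω := Measure.ofMeasurable
    (fun A _ => ENNReal.ofReal (L (A.indicator fun _ => 1))) (by rw [hempty, ENNReal.ofReal_zero]) (by
      intro f hf hd
      have hU : MeasurableSet (⋃ i, f i) := MeasurableSet.iUnion hf
      have hAm : ∀ n, MeasurableSet (⋃ i ∈ Finset.range n, f i) := fun n =>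
        Finset.measurableSet_biUnion _ fun i _ => hf i
      have hind : ∀ n, ((⋃ i ∈ Finset.range n, f i).indicator fun _ => (1:ℝ)) =
          ∑ i ∈ Finset.range n, (f i).indicator fun _ => (1:ℝ) := by
        intro n
        ext ω
        rw [Finset.indicator_biUnion_apply, Finset.sum_apply]
        exact fun i _ j _ hij => hd hij
      have hpart : ∀ n, L ((⋃ i ∈ Finset.range n, f i).indicator fun _ => (1:ℝ)) =
          ∑ i ∈ Finset.range n, L ((f i).indicator fun _ => (1:ℝ)) := by
        intro n
        rw [hind, (hbsum _ (fun i => bddRV_indicator (hf i)) n).2]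
      have hle : ∀ n, ∑ i ∈ Finset.range n, L ((f i).indicator fun _ => (1:ℝ)) ≤
          L ((⋃ i, f i).indicator fun _ => (1:ℝ)) := by
        intro n
        rw [← hpart]
        refine hM _ _ (bddRV_indicator (hAm n)) (bddRV_indicator hU) (Eventually.of_forall fun ω => ?_)
        refine indicator_le_indicator_of_subset ?_ (fun _ => zero_le_one) ω
        exact iUnion₂_subset fun i _ => subset_iUnion f i
      have hsm : Summable fun i => L ((f i).indicator fun _ => (1:ℝ)) :=
        summable_of_sum_range_le (fun i => hpos _ (hf i)) hle
      have ht := hsm.hasSum.tendsto_sum_nat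
      have hge := hIC (fun n => ⋃ i ∈ Finset.range n, f i) (⋃ i, f i) hAm (by
        intro m n hmn
        exact biUnion_subset_biUnion_left fun i hi => Finset.range_mono hmn hi) (by
        ext ω
        simp only [mem_iUnion, Finset.mem_range]
        constructor
        · rintro ⟨i, hi⟩
          exact ⟨i+1, i, Nat.lt_succ_self i, hi⟩
        · rintro ⟨n, i, -, hi⟩
          exact ⟨i, hi⟩)
      simp_rw [hpart] at hge
      rw [ht.liminf_eq] at hge
      have heq := le_antisymm hge (le_of_tendsto' ht hle)
      rw [heq, ENNReal.ofReal_tsum_of_nonneg (fun i => hpos _ (hf i)) hsm])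
  have hμ : ∀ A, MeasurableSet A → μ A = ENNReal.ofReal (L (A.indicator fun _ => 1)) :=
    fun A hA => Measure.ofMeasurable_apply A hA
  have hprob : IsProbabilityMeasure μ := ⟨by
    rw [hμ _ MeasurableSet.univ, indicator_univ, hN, ENNReal.ofReal_one]⟩
  refine ⟨μ, hprob, hμ, ?_⟩
  have hμind : ∀ A, MeasurableSet A → L (A.indicator fun _ => 1) = ∫ ω, A.indicator (fun _ => (1:ℝ)) ω ∂μ := by
    intro A hA
    rw [integral_indicator_const _ hA, measureReal_def, hμ A hA, ENNReal.toReal_ofReal (hpos A hA)]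
    simp
  -- natural-number valued
  have hnat : ∀ (Z : Ω → ℕ) (K : ℕ), Measurable Z → (∀ ω, Z ω ≤ K) →
      BddRV (fun ω => (Z ω : ℝ)) ∧ L (fun ω => (Z ω : ℝ)) = ∫ ω, (Z ω : ℝ) ∂μ := by
    intro Z K hZ hK
    have hA : ∀ j, MeasurableSet {ω | j < Z ω} := fun j => measurableSet_lt measurable_const hZ
    have hs : (fun ω => (Z ω : ℝ)) =
        ∑ j ∈ Finset.range K, {ω | j < Z ω}.indicator (fun _ => (1:ℝ)) := by
      ext ω
      rw [Finset.sum_apply]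
      simp only [indicator_apply, mem_ofPred_eq]
      rw [Finset.sum_boole]
      congr 1
      have : Finset.filter (fun j => j < Z ω) (Finset.range K) = Finset.range (Z ω) := by
        ext j
        simp only [Finset.mem_filter, Finset.mem_range]
        exact ⟨fun h => h.2, fun h => ⟨h.trans_le (hK ω), h⟩⟩
      rw [this, Finset.card_range]
    have hb := hbsum _ (fun j => bddRV_indicator (hA j)) K
    refine ⟨hs ▸ hb.1, ?_⟩
    have hL := congrArg L hs
    rw [hb.2] at hL
    rw [hL]
    have : ∫ ω, (Z ω : ℝ) ∂μ = ∫ ω, ∑ j ∈ Finset.range K, {ω | j < Z ω}.indicator (fun _ => (1:ℝ)) ω ∂μ := by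
      refine integral_congr_ae (Eventually.of_forall fun ω => ?_)
      have := congrFun hs ω
      rwa [Finset.sum_apply] at this
    rw [this, integral_finsetSum _ fun j _ => (bddRV_indicator (hA j)).integrable']
    exact Finset.sum_congr rfl fun j _ => hμind _ (hA j)
  have hsmul : ∀ (X : Ω → ℝ), BddRV X → ∀ n : ℕ, BddRV (fun ω => n * X ω) ∧
      L (fun ω => n * X ω) = n * L X := by
    intro X hX n
    have hb := hbsum (fun _ => X) (fun _ => hX) n
    have e : (∑ i ∈ Finset.range n, X) = fun ω => n * X ω := by
      ext ω; simp
    rw [e] at hb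
    exact ⟨hb.1, by rw [hb.2]; simp⟩
  -- nonnegative
  have hnn : ∀ X, BddRV X → (∀ ω, 0 ≤ X ω) → L X = ∫ ω, X ω ∂μ := by
    intro X hX hX0
    have key : ∀ n : ℕ, |n * (L X - ∫ ω, X ω ∂μ)| ≤ 1 := by
      intro n
      obtain ⟨hbn, hLn⟩ := hsmul X hX n
      obtain ⟨C, hC⟩ := hX.2
      obtain ⟨K, hK⟩ := exists_nat_ge (n * C)
      have hZm : Measurable fun ω => ⌊n * X ω⌋₊ := Nat.measurable_floor.comp hbn.1
      obtain ⟨hZb, hZ⟩ := hnat (fun ω => ⌊n * X ω⌋₊) K hZm (fun ω => by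
        refine Nat.floor_le_of_le (le_trans ?_ hK)
        exact mul_le_mul_of_nonneg_left ((le_abs_self _).trans (hC ω)) (Nat.cast_nonneg n))
      have l1 := hM _ _ hZb hbn (Eventually.of_forall fun ω =>
        Nat.floor_le (mul_nonneg (Nat.cast_nonneg n) (hX0 ω)))
      have l2 := hM _ _ hbn (hZb.add' (bddRV_const 1)) (Eventually.of_forall fun ω =>
        (Nat.lt_floor_add_one _).le)
      rw [hAD _ _ hZb (bddRV_const 1), hN] at l2
      have i1 : ∫ ω, (⌊n * X ω⌋₊ : ℝ) ∂μ ≤ ∫ ω, n * X ω ∂μ :=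
        integral_mono hZb.integrable' hbn.integrable' fun ω =>
          Nat.floor_le (mul_nonneg (Nat.cast_nonneg n) (hX0 ω))
      have i2 : ∫ ω, n * X ω ∂μ ≤ ∫ ω, ((⌊n * X ω⌋₊ : ℝ) + 1) ∂μ :=
        integral_mono hbn.integrable' (hZb.integrable'.add (integrable_const 1)) fun ω =>
          (Nat.lt_floor_add_one _).le
      rw [integral_add hZb.integrable' (integrable_const 1)] at i2
      rw [integral_const_mul] at i1 i2
      simp only [integral_const, probReal_univ, smul_eq_mul, mul_one] at i2
      rw [hLn, hZ] at l1 l2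
      rw [mul_sub, abs_le]
      constructor <;> linarith
    by_contra hne
    have hd : 0 < |L X - ∫ ω, X ω ∂μ| := abs_pos.mpr (sub_ne_zero.mpr hne)
    obtain ⟨n, hn⟩ := exists_nat_gt (1 / |L X - ∫ ω, X ω ∂μ|)
    have := key n
    rw [abs_mul, Nat.abs_cast] at this
    rw [div_lt_iff₀ hd] at hn
    linarith
  intro X hX
  obtain ⟨C, hC⟩ := hX.2
  have hc0 : ∀ _ : Ω, 0 ≤ |C| := fun _ => abs_nonneg C
  have e1 := hnn (X + fun _ => |C|) (hX.add' (bddRV_const _)) (fun ω => by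
    have := abs_le.mp (hC ω)
    have := le_abs_self C
    simp only [Pi.add_apply]
    linarith)
  have e2 := hnn (fun _ => |C|) (bddRV_const _) hc0
  rw [hAD _ _ hX (bddRV_const _), e2] at e1
  simp only [Pi.add_apply] at e1
  rw [integral_add hX.integrable' (integrable_const _)] at e1
  linarith

lemma joint_law_eq {Ω : Type*} [MeasurableSpace Ω] (P : Measure Ω) [IsProbabilityMeasure P]
    {N : ℕ} (W W' : Ω → (Fin N → ℝ)) (hW : Measurable W) (hW' : Measurable W')
    (S S' : Set Ω) (hS : MeasurableSet S) (hS' : MeasurableSet S')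
    (hWW : P.map W = P.map W')
    (hSS : ∀ T, MeasurableSet T → P (S ∩ W ⁻¹' T) = P (S' ∩ W' ⁻¹' T)) :
    (P.map fun ω => (S.indicator (fun _ => (1:ℝ)) ω, W ω)) =
      (P.map fun ω => (S'.indicator (fun _ => (1:ℝ)) ω, W' ω)) := by
  have hc : ∀ T, MeasurableSet T → P (Sᶜ ∩ W ⁻¹' T) = P (S'ᶜ ∩ W' ⁻¹' T) := by
    intro T hT
    have h1 : P (S ∩ W ⁻¹' T) + P (Sᶜ ∩ W ⁻¹' T) = P (W ⁻¹' T) := by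
      rw [inter_comm S, inter_comm Sᶜ]
      exact measure_inter_add_sdiff (W ⁻¹' T) hS
    have h2 : P (S' ∩ W' ⁻¹' T) + P (S'ᶜ ∩ W' ⁻¹' T) = P (W' ⁻¹' T) := by
      rw [inter_comm S', inter_comm S'ᶜ]
      exact measure_inter_add_sdiff (W' ⁻¹' T) hS'
    have h3 : P (W ⁻¹' T) = P (W' ⁻¹' T) := by
      rw [← Measure.map_apply hW hT, ← Measure.map_apply hW' hT, hWW]
    rw [← h1, ← h2, hSS T hT] at h3
    exact (ENNReal.add_right_inj (measure_ne_top _ _)).mp h3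
  have gen : ∀ (W : Ω → (Fin N → ℝ)) (hW : Measurable W) (S : Set Ω) (hS : MeasurableSet S)
      (E : Set (ℝ × (Fin N → ℝ))), MeasurableSet E →
      (P.map fun ω => (S.indicator (fun _ => (1:ℝ)) ω, W ω)) E =
        P (S ∩ W ⁻¹' (Prod.mk 1 ⁻¹' E)) + P (Sᶜ ∩ W ⁻¹' (Prod.mk 0 ⁻¹' E)) := by
    intro W hW S hS E hE
    rw [Measure.map_apply ((bddRV_indicator hS).1.prodMk hW) hE, ← measure_inter_add_sdiff _ hS]
    congr 2
    · ext ω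
      by_cases h : ω ∈ S <;> simp [h]
    · ext ω
      by_cases h : ω ∈ S <;> simp [h]
  ext E hE
  rw [gen W hW S hS E hE, gen W' hW' S' hS' E hE, hSS _ (measurable_prodMk_left hE),
    hc _ (measurable_prodMk_left hE)]

lemma key_indicator {Ω : Type*} [MeasurableSpace Ω] (P : Measure Ω) [IsProbabilityMeasure P]
    (hatomless : Atomless P) {N : ℕ}
    (m : (Ω → (Fin N → ℝ)) → Measure Ω)
    (hm : ∀ W, Measurable W → IsProbabilityMeasure (m W))
    (hLI : ∀ W W' S S', Measurable W → Measurable W' → MeasurableSet S → MeasurableSet S' →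
      P.map W = P.map W' → (∀ T, MeasurableSet T → P (S ∩ W ⁻¹' T) = P (S' ∩ W' ⁻¹' T)) →
      m W S = m W' S')
    (W : Ω → (Fin N → ℝ)) (hW : Measurable W) (A : Set Ω) (hA : MeasurableSet A)
    (p : (Fin N → ℝ) → ℝ) (hp : Measurable p) (hp01 : ∀ w, p w ∈ Icc (0:ℝ) 1)
    (hpA : ∀ T, MeasurableSet T → P (A ∩ W ⁻¹' T) = ∫⁻ w in T, ENNReal.ofReal (p w) ∂(P.map W)) :
    m W A = ∫⁻ w, ENNReal.ofReal (p w) ∂((m W).map W) := by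
  have : IsProbabilityMeasure (P.map W) := Measure.isProbabilityMeasure_map hW.aemeasurable
  have hcp : IsProbabilityMeasure (volume : Measure UnitAddCircle) := ⟨by simp⟩
  obtain ⟨c, hc, hcv⟩ := exists_circle_coord
  obtain ⟨f, hf, hfπ⟩ := exists_law P hatomless ((P.map W).prod (volume : Measure UnitAddCircle))
  let W' : Ω → (Fin N → ℝ) := fun ω => (f ω).1
  let V : Ω → UnitAddCircle := fun ω => (f ω).2
  have hW' : Measurable W' := measurable_fst.comp hf
  have hV : Measurable V := measurable_snd.comp hf
  have hWW : P.map W = P.map W' := by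
    have h1 : P.map W' = (P.map f).map Prod.fst := (Measure.map_map measurable_fst hf).symm
    rw [h1, hfπ, Measure.map_fst_prod]
    simp
  have := hm W hW
  have := hm W' hW'
  have hvol : ∀ (s : UnitAddCircle) w, volume {v | c (v + s) ≤ p w} = ENNReal.ofReal (p w) := by
    intro s w
    rw [← hcv _ (hp01 w)]
    exact measure_preimage_add_right volume s {v | c v ≤ p w}
  have hB : ∀ s : UnitAddCircle, MeasurableSet {ω | c (V ω + s) ≤ p (W' ω)} := fun s =>
    measurableSet_le (hc.comp (hV.add_const s)) (hp.comp hW')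
  have hms : ∀ s : UnitAddCircle, m W A = m W' {ω | c (V ω + s) ≤ p (W' ω)} := by
    intro s
    refine hLI W W' A _ hW hW' hA (hB s) hWW fun T hT => ?_
    rw [hpA T hT]
    have hE : MeasurableSet {z : (Fin N → ℝ) × UnitAddCircle | c (z.2 + s) ≤ p z.1 ∧ z.1 ∈ T} :=
      (measurableSet_le (hc.comp (measurable_snd.add_const s)) (hp.comp measurable_fst)).inter
        (measurable_fst hT)
    have h1 : P ({ω | c (V ω + s) ≤ p (W' ω)} ∩ W' ⁻¹' T) =
        ((P.map W).prod (volume : Measure UnitAddCircle)) {z | c (z.2 + s) ≤ p z.1 ∧ z.1 ∈ T} := by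
      rw [← hfπ, Measure.map_apply hf hE]
      rfl
    rw [h1, Measure.prod_apply hE, ← lintegral_indicator hT]
    refine lintegral_congr fun w => ?_
    by_cases hw : w ∈ T
    · rw [indicator_of_mem hw, ← hvol s w]
      congr 1
      ext v
      simp [hw]
    · rw [indicator_of_notMem hw]
      simp [hw]
  have hE : MeasurableSet {z : Ω × UnitAddCircle | c (V z.1 + z.2) ≤ p (W' z.1)} :=
    measurableSet_le (hc.comp ((hV.comp measurable_fst).add measurable_snd))
      ((hp.comp hW').comp measurable_fst)
  have h1 := Measure.prod_apply (μ := m W') (ν := (volume : Measure UnitAddCircle)) hE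
  have h2 := Measure.prod_apply_symm (μ := m W') (ν := (volume : Measure UnitAddCircle)) hE
  have h3 : m W A = ((m W').prod (volume : Measure UnitAddCircle))
      {z : Ω × UnitAddCircle | c (V z.1 + z.2) ≤ p (W' z.1)} := by
    rw [h2]
    have : ∀ s : UnitAddCircle, m W' ((fun ω => (ω, s)) ⁻¹'
        {z : Ω × UnitAddCircle | c (V z.1 + z.2) ≤ p (W' z.1)}) = m W A := fun s => (hms s).symm
    simp_rw [this]
    simp
  have h4 : (m W).map W = (m W').map W' := by
    ext T hT
    rw [Measure.map_apply hW hT, Measure.map_apply hW' hT]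
    refine hLI W W' _ _ hW hW' (hW hT) (hW' hT) hWW fun S hS => ?_
    rw [← preimage_inter, ← preimage_inter, ← Measure.map_apply hW (hT.inter hS), hWW,
      Measure.map_apply hW' (hT.inter hS)]
  rw [h3, h1, h4, lintegral_map hp.ennreal_ofReal hW']
  refine lintegral_congr fun ω => ?_
  rw [← hvol (V ω) (W' ω)]
  congr 1
  ext s
  simp [add_comm]

lemma exists_prob_version {Ω : Type*} [MeasurableSpace Ω] (P : Measure Ω) [IsProbabilityMeasure P]
    {N : ℕ} (W : Ω → (Fin N → ℝ)) (hW : Measurable W) (A : Set Ω) (hA : MeasurableSet A) :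
    ∃ p : (Fin N → ℝ) → ℝ, IsCondExpVersion P (A.indicator fun _ => 1) W p ∧
      (∀ w, p w ∈ Icc (0:ℝ) 1) ∧ 
      ∀ T, MeasurableSet T → P (A ∩ W ⁻¹' T) = ∫⁻ w in T, ENNReal.ofReal (p w) ∂(P.map W) := by
  have : IsProbabilityMeasure (P.map W) := Measure.isProbabilityMeasure_map hW.aemeasurable
  obtain ⟨g, hg, hgi, hgW⟩ := exists_version P _ W (bddRV_indicator hA) hW
  let p : (Fin N → ℝ) → ℝ := fun w => max 0 (min (g w) 1)
  have hp : Measurable p := measurable_const.max (hg.1.min measurable_const)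
  have hp01 : ∀ w, p w ∈ Icc (0:ℝ) 1 := fun w =>
    ⟨le_max_left _ _, max_le zero_le_one (min_le_right _ _)⟩
  have h0 : ∀ᵐ w ∂(P.map W), 0 ≤ g w := by
    rw [ae_map_iff hW.aemeasurable (measurableSet_le measurable_const hg.1)]
    have := condExp_mono (m := MeasurableSpace.comap W inferInstance) (μ := P)
      (integrable_const 0) (bddRV_indicator hA).integrable'
      (Eventually.of_forall fun ω => (indicator_nonneg (fun _ _ => zero_le_one) ω : (0:ℝ) ≤ _))
    rw [← hgW, condExp_const hW.comap_le] at this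
    exact this
  have h1 : ∀ᵐ w ∂(P.map W), g w ≤ 1 := by
    rw [ae_map_iff hW.aemeasurable (measurableSet_le hg.1 measurable_const)]
    have := condExp_mono (m := MeasurableSpace.comap W inferInstance) (μ := P)
      (bddRV_indicator hA).integrable' (integrable_const 1)
      (Eventually.of_forall fun ω => (indicator_le_self' (fun _ _ => zero_le_one) ω :
        (A.indicator (fun _ => (1:ℝ)) ω ≤ 1)))
    rw [← hgW, condExp_const hW.comap_le] at this
    exact this
  have hae : g =ᵐ[P.map W] p := by
    filter_upwards [h0, h1] with w hw0 hw1
    simp only [p]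
    rw [min_eq_left hw1, max_eq_right hw0]
  have hpv : IsCondExpVersion P (A.indicator fun _ => 1) W p := by
    refine ⟨hp, fun S hS => ?_⟩
    rw [hg.2 S hS]
    exact integral_congr_ae (ae_restrict_of_ae hae)
  refine ⟨p, hpv, hp01, fun T hT => ?_⟩
  have h2 := hpv.2 T hT
  have hpi : Integrable p ((P.map W).restrict T) := 
    Integrable.of_bound hp.aestronglyMeasurable 1 (Eventually.of_forall fun w => by
      rw [Real.norm_of_nonneg (hp01 w).1]; exact (hp01 w).2)
  rw [← ofReal_integral_eq_lintegral_ofReal hpi (Eventually.of_forall fun w => (hp01 w).1), ← h2,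
    integral_indicator_const _ hA]
  simp [measureReal_def, Measure.restrict_apply hA]

theorem forward {Ω : Type*} [MeasurableSpace Ω] (P : Measure Ω) [IsProbabilityMeasure P]
    (hatomless : Atomless P) {N : ℕ}
    (ρ : (Ω → ℝ) → (Ω → (Fin N → ℝ)) → ℝ)
    (hM : ∀ X Y W, BddRV X → BddRV Y → Measurable W → (∀ᵐ ω ∂P, X ω ≤ Y ω) → ρ X W ≤ ρ Y W)
    (hAD : ∀ X Y W, BddRV X → BddRV Y → Measurable W → ρ (X + Y) W = ρ X W + ρ Y W)
    (hIC : ∀ (A : ℕ → Set Ω) (Alim : Set Ω), (∀ n, MeasurableSet (A n)) → Monotone A →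
        Alim = ⋃ n, A n → ∀ W : Ω → (Fin N → ℝ), Measurable W →
        ρ (Alim.indicator fun _ => 1) W ≤
          liminf (fun n => ρ ((A n).indicator fun _ => 1) W) atTop)
    (hN : ∀ W : Ω → (Fin N → ℝ), Measurable W → ρ (fun _ => 1) W = 1)
    (hLI : ∀ X X' W W', BddRV X → BddRV X' → Measurable W → Measurable W' →
        (P.map fun ω => (X ω, W ω)) = (P.map fun ω => (X' ω, W' ω)) → ρ X W = ρ X' W') :
    ∃ Q : (Ω → (Fin N → ℝ)) → Measure (Fin N → ℝ),
      (∀ W : Ω → (Fin N → ℝ), Measurable W →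
        IsProbabilityMeasure (Q W) ∧ Q W ≪ P.map W) ∧
      (∀ W W' : Ω → (Fin N → ℝ), Measurable W → Measurable W' →
        P.map W = P.map W' → Q W = Q W') ∧
      (∀ X W, BddRV X → Measurable W →
        ∀ g : (Fin N → ℝ) → ℝ, IsCondExpVersion P X W g →
          ρ X W = ∫ w, g w ∂(Q W)) := by
  have hex : ∀ W : Ω → (Fin N → ℝ), ∃ μ : Measure Ω, Measurable W → IsProbabilityMeasure μ ∧
      (∀ A, MeasurableSet A → μ A = ENNReal.ofReal (ρ (A.indicator fun _ => 1) W)) ∧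
      ∀ X, BddRV X → ρ X W = ∫ ω, X ω ∂μ := by
    intro W
    by_cases hW : Measurable W
    · obtain ⟨μ, h⟩ := functional_rep P (fun X => ρ X W)
        (fun X Y hX hY h => hM X Y W hX hY hW h) (fun X Y hX hY => hAD X Y W hX hY hW)
        (fun A Al hA hm hl => hIC A Al hA hm hl W hW) (hN W hW)
      exact ⟨μ, fun _ => h⟩
    · exact ⟨0, fun h => absurd h hW⟩
  choose m hm using hex
  have hmLI : ∀ W W' S S', Measurable W → Measurable W' → MeasurableSet S → MeasurableSet S' →
      P.map W = P.map W' → (∀ T, MeasurableSet T → P (S ∩ W ⁻¹' T) = P (S' ∩ W' ⁻¹' T)) →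
      m W S = m W' S' := by
    intro W W' S S' hW hW' hS hS' hWW hSS
    rw [(hm W hW).2.1 S hS, (hm W' hW').2.1 S' hS']
    rw [hLI _ _ W W' (bddRV_indicator hS) (bddRV_indicator hS') hW hW'
      (joint_law_eq P W W' hW hW' S S' hS hS' hWW hSS)]
  have hprob : ∀ W, Measurable W → IsProbabilityMeasure ((m W).map W) := by
    intro W hW
    have := (hm W hW).1
    exact Measure.isProbabilityMeasure_map hW.aemeasurable
  have hac : ∀ W, Measurable W → (m W).map W ≪ P.map W := by
    intro W hW
    refine Measure.AbsolutelyContinuous.mk fun T hT h0 => ?_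
    rw [Measure.map_apply hW hT] at h0 ⊢
    have : m W (W ⁻¹' T) = m W ∅ := by
      refine hmLI W W _ _ hW hW (hW hT) MeasurableSet.empty rfl fun S hS => ?_
      rw [empty_inter, measure_empty]
      exact measure_mono_null inter_subset_left h0
    rw [this, measure_empty]
  refine ⟨fun W => (m W).map W, fun W hW => ⟨hprob W hW, hac W hW⟩, ?_, ?_⟩
  · intro W W' hW hW' hWW
    ext T hT
    rw [Measure.map_apply hW hT, Measure.map_apply hW' hT]
    refine hmLI W W' _ _ hW hW' (hW hT) (hW' hT) hWW fun S hS => ?_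
    rw [← preimage_inter, ← preimage_inter, ← Measure.map_apply hW (hT.inter hS), hWW,
      Measure.map_apply hW' (hT.inter hS)]
  · intro X W hX hW g hg
    have := hprob W hW
    have := (hm W hW).1
    have : IsProbabilityMeasure (P.map W) := Measure.isProbabilityMeasure_map hW.aemeasurable
    set Q := (m W).map W with hQ
    let d : Ω → NNReal := fun ω => (Q.rnDeriv (P.map W) (W ω)).toNNReal
    have hd : Measurable d := ((Measure.measurable_rnDeriv _ _).comp hW).ennreal_toNNReal
    have hmd : m W = P.withDensity fun ω => (d ω : ENNReal) := by
      ext A hA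
      obtain ⟨p, hpv, hp01, hpA⟩ := exists_prob_version P W hW A hA
      rw [key_indicator P hatomless m (fun W hW => (hm W hW).1) hmLI W hW A hA p hpv.1 hp01 hpA]
      have hpi : Integrable p Q := 
        Integrable.of_bound hpv.1.aestronglyMeasurable 1 (Eventually.of_forall fun w => by
          rw [Real.norm_of_nonneg (hp01 w).1]; exact (hp01 w).2)
      rw [← hQ, ← ofReal_integral_eq_lintegral_ofReal hpi (Eventually.of_forall fun w => (hp01 w).1),
        version_rep P _ W (bddRV_indicator hA) hW p hpv Q (hac W hW),
        ofReal_integral_eq_lintegral_ofReal (integrable_dens P _ W (bddRV_indicator hA) hW Q)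
          (Eventually.of_forall fun ω => mul_nonneg (indicator_nonneg (fun _ _ => zero_le_one) ω)
            ENNReal.toReal_nonneg), withDensity_apply _ hA, ← lintegral_indicator hA]
      refine lintegral_congr fun ω => ?_
      by_cases hω : ω ∈ A
      · rw [indicator_of_mem hω, indicator_of_mem hω, one_mul]
        exact ENNReal.ofReal_coe_nnreal
      · simp [hω]
    rw [(hm W hW).2.2 X hX, version_rep P X W hX hW g hg Q (hac W hW), hmd,
      integral_withDensity_eq_integral_smul hd]
    refine integral_congr_ae (Eventually.of_forall fun ω => ?_)
    simp only [NNReal.smul_def, smul_eq_mul]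
    exact mul_comm _ _

/-- **Theorem (linear factor risk measures).** `ρ` satisfies M, AD, IC, N and LI iff it
is a weighted average `ρ(X, W) = ∫ E(X | W = w) dQ_W(w)` for a law-invariant family of
probability measures `Q_W ≪ P ∘ W⁻¹`. -/
theorem stmt11 {Ω : Type*} [MeasurableSpace Ω] (P : Measure Ω) [IsProbabilityMeasure P]
    (hatomless : Atomless P) {N : ℕ} (hN : 1 ≤ N)
    (ρ : (Ω → ℝ) → (Ω → (Fin N → ℝ)) → ℝ) :
    ((∀ X Y W, BddRV X → BddRV Y → Measurable W → (∀ᵐ ω ∂P, X ω ≤ Y ω) → ρ X W ≤ ρ Y W) ∧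
     -- AD : additivity
     (∀ X Y W, BddRV X → BddRV Y → Measurable W → ρ (X + Y) W = ρ X W + ρ Y W) ∧
     -- IC : indicator lower semicontinuity
     (∀ (A : ℕ → Set Ω) (Alim : Set Ω), (∀ n, MeasurableSet (A n)) → Monotone A →
        Alim = ⋃ n, A n → ∀ W : Ω → (Fin N → ℝ), Measurable W →
        ρ (Alim.indicator fun _ => 1) W ≤
          liminf (fun n => ρ ((A n).indicator fun _ => 1) W) atTop) ∧
     (∀ W : Ω → (Fin N → ℝ), Measurable W → ρ (fun _ => 1) W = 1) ∧
     (∀ X X' W W', BddRV X → BddRV X' → Measurable W → Measurable W' →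
        (P.map fun ω => (X ω, W ω)) = (P.map fun ω => (X' ω, W' ω)) → ρ X W = ρ X' W'))
    ↔
    ∃ Q : (Ω → (Fin N → ℝ)) → Measure (Fin N → ℝ),
      (∀ W : Ω → (Fin N → ℝ), Measurable W →
        IsProbabilityMeasure (Q W) ∧ Q W ≪ P.map W) ∧
      (∀ W W' : Ω → (Fin N → ℝ), Measurable W → Measurable W' →
        P.map W = P.map W' → Q W = Q W') ∧
      (∀ X W, BddRV X → Measurable W →
        ∀ g : (Fin N → ℝ) → ℝ, IsCondExpVersion P X W g →
          ρ X W = ∫ w, g w ∂(Q W)) := by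

  constructor
  · rintro ⟨hM, hAD, hIC, hNm, hLI⟩
    exact forward P hatomless ρ hM hAD hIC hNm hLI
  · rintro ⟨Q, hQ, hQL, hr⟩
    exact backward P ρ Q hQ hQL hr
end
end

section
/- Assume that for every W ∈ 𝒴 there exists a random variable U uniformly distributed on (0,1) that is independent of W. For X ∈ L^∞, W ∈ 𝒴 and Y ∈ L¹, let L(X, W) = {Z ∈ L^∞ : (Z, W) equals (X, W) in joint distribution}. Then sup_{Z ∈ L(X,W)} 𝔼(ZY) = 𝔼( ∫₀¹ VaR_t(X | W) · VaR_t(Y | W) dt ) and inf_{Z ∈ L(X,W)} 𝔼(ZY) = 𝔼( ∫₀¹ VaR_{1−t}(X | W) · VaR_t(Y | W) dt ). -/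
open MeasureTheory ProbabilityTheory Set Filter

noncomputable section

/-- Conditional left quantile `VaR_t(X | W)` evaluated at `w`, built from a kernel
version `K` of the conditional distribution of `X` given `W`. -/
def condVaR {N : ℕ} (K : Kernel (Fin N → ℝ) ℝ) (w : Fin N → ℝ) (t : ℝ) : ℝ :=
  sInf {x : ℝ | t ≤ (K w (Iic x)).toReal}

lemma quant_le_iff (ν : Measure ℝ) [IsProbabilityMeasure ν] {t : ℝ} (ht : t ∈ Ioo (0:ℝ) 1) (x : ℝ) :
    sInf {x : ℝ | t ≤ (ν (Iic x)).toReal} ≤ x ↔ t ≤ (ν (Iic x)).toReal := by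
  have hc : ∀ x, (ν (Iic x)).toReal = cdf ν x := fun x => by
    rw [cdf_eq_real]; rfl
  simp only [hc]
  have hbdd : BddBelow {x : ℝ | t ≤ cdf ν x} := by
    have h := (tendsto_cdf_atBot ν).eventually (gt_mem_nhds ht.1)
    obtain ⟨b, hb⟩ := h.exists
    refine ⟨b, fun x hx => ?_⟩
    by_contra hlt
    exact absurd (hx.trans (monotone_cdf ν (le_of_not_ge hlt))) (not_le.2 hb)
  have hne : {x : ℝ | t ≤ cdf ν x}.Nonempty := by
    have h := (tendsto_cdf_atTop ν).eventually (lt_mem_nhds ht.2)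
    obtain ⟨b, hb⟩ := h.exists
    exact ⟨b, hb.le⟩
  constructor
  · intro h
    have hr : ContinuousWithinAt (cdf ν) (Ioi x) x :=
      ((cdf ν).right_continuous x).mono Ioi_subset_Ici_self
    refine ge_of_tendsto hr ?_
    filter_upwards [self_mem_nhdsWithin] with y hy
    obtain ⟨z, hz, hzy⟩ := exists_lt_of_csInf_lt hne (lt_of_le_of_lt h hy)
    exact le_trans hz (monotone_cdf ν hzy.le)
  · intro h
    exact csInf_le hbdd h

lemma exists_Iic_eq (m : Measure ℝ) [IsFiniteMeasure m] (hm : ∀ x, m {x} = 0) {s : ℝ} (h0 : 0 < s)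
    (h1 : s < m.real univ) : ∃ u, m.real (Iic u) = s := by
  have : NullSingletonClass m := ⟨hm⟩
  have hcont : Continuous fun u => m.real (Iic u) := by
    have h2 : (fun u => m.real (Iic u)) =
        fun u => m.real (Iic 0) + ∫ x in (0:ℝ)..u, (1:ℝ) ∂m := by
      funext u
      rw [← intervalIntegral.integral_Iic_sub_Iic]
      · simp
      · simp
      · simp
    rw [h2]
    refine continuous_const.add (intervalIntegral.continuous_primitive (fun a b => ?_) 0)
    exact intervalIntegrable_const
  have hbot : Tendsto (fun u => m.real (Iic u)) atBot (nhds 0) := by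
    have h := tendsto_measure_iInter_atBot (μ := m) (s := fun u : ℝ => Iic u)
      (fun u => measurableSet_Iic.nullMeasurableSet) (fun u v huv => Iic_subset_Iic.2 huv)
      ⟨0, measure_ne_top _ _⟩
    have h2 : (⋂ u : ℝ, Iic u) = ∅ := by
      ext x; simp only [mem_iInter, mem_Iic, mem_empty_iff_false, iff_false, not_forall, not_le]
      exact ⟨x - 1, by linarith⟩
    rw [h2, measure_empty] at h
    exact (ENNReal.tendsto_toReal (by simp)).comp h
  have htop : Tendsto (fun u => m.real (Iic u)) atTop (nhds (m.real univ)) := by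
    have := tendsto_measure_Iic_atTop m
    exact (ENNReal.tendsto_toReal (by simp)).comp this
  obtain ⟨a, ha⟩ := (hbot.eventually (gt_mem_nhds h0)).exists
  obtain ⟨b, hb⟩ := (htop.eventually (lt_mem_nhds h1)).exists
  exact mem_range_of_exists_le_of_exists_ge hcont ⟨a, ha.le⟩ ⟨b, hb.le⟩

lemma noatom_bounds (m : Measure ℝ) [IsFiniteMeasure m] (hm : ∀ x, m {x} = 0) {s : ℝ} (h0 : 0 ≤ s)
    (h1 : s ≤ m.real univ) :
    m.real {u | m.real (Iic u) < s} ≤ s ∧ s ≤ m.real {u | m.real (Iic u) ≤ s} := by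
  rcases h0.eq_or_lt with rfl | h0
  · refine ⟨?_, measureReal_nonneg⟩
    have : {u | m.real (Iic u) < 0} = ∅ := by
      ext u; simp [measureReal_nonneg]
    rw [this]; simp
  rcases h1.eq_or_lt with h1 | h1
  · refine ⟨?_, ?_⟩
    · rw [h1]; exact measureReal_mono (subset_univ _)
    · have : {u | m.real (Iic u) ≤ s} = univ := by
        ext u; simp only [mem_ofPred_eq, mem_univ, iff_true]; rw [h1]
        exact measureReal_mono (subset_univ _)
      rw [this, h1]
  obtain ⟨u, hu⟩ := exists_Iic_eq m hm h0 h1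
  constructor
  · calc _ ≤ m.real (Iic u) := measureReal_mono (fun v hv => by
          by_contra hlt
          have : m.real (Iic u) ≤ m.real (Iic v) :=
            measureReal_mono (Iic_subset_Iic.2 (le_of_not_ge hlt))
          have hv' : m.real (Iic v) < s := hv
          linarith)
      _ = s := hu
  · calc s = m.real (Iic u) := hu.symm
      _ ≤ _ := measureReal_mono (fun v hv => by
          have : m.real (Iic v) ≤ m.real (Iic u) := measureReal_mono (Iic_subset_Iic.2 hv)
          show m.real (Iic v) ≤ s
          linarith)

def lexL (z : ℝ × ℝ) : Set (ℝ × ℝ) := {z' | z'.1 < z.1 ∨ (z'.1 = z.1 ∧ z'.2 ≤ z.2)}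

lemma lexL_meas : MeasurableSet {p : (ℝ × ℝ) × (ℝ × ℝ) | p.2 ∈ lexL p.1} := by
  have h1 : MeasurableSet {p : (ℝ × ℝ) × (ℝ × ℝ) | p.2.1 < p.1.1} :=
    measurableSet_lt (by fun_prop) (by fun_prop)
  have h2 : MeasurableSet {p : (ℝ × ℝ) × (ℝ × ℝ) | p.2.1 = p.1.1} :=
    measurableSet_eq_fun (by fun_prop) (by fun_prop)
  have h3 : MeasurableSet {p : (ℝ × ℝ) × (ℝ × ℝ) | p.2.2 ≤ p.1.2} :=
    measurableSet_le (by fun_prop) (by fun_prop)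
  exact h1.union (h2.inter h3)

lemma lexL_meas1 (z : ℝ × ℝ) : MeasurableSet (lexL z) :=
  measurable_prodMk_left (x := z) lexL_meas

lemma lexG_meas (ν : Measure (ℝ × ℝ)) [IsProbabilityMeasure ν] :
    Measurable fun z => ν.real (lexL z) :=
  (measurable_measure_prodMk_left (ν := ν) lexL_meas).ennreal_toReal

lemma lex_bounds (ν : Measure (ℝ × ℝ)) [IsProbabilityMeasure ν]
    (hν : ∀ u, ν (Prod.snd ⁻¹' {u}) = 0) {t : ℝ} (ht : t ∈ Ioo (0:ℝ) 1) :
    ν.real {z | ν.real (lexL z) < t} ≤ t ∧ t ≤ ν.real {z | ν.real (lexL z) ≤ t} := by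
  set μ := ν.map Prod.fst with hμ
  have : IsProbabilityMeasure μ := Measure.isProbabilityMeasure_map (by fun_prop)
  have hF : ∀ y, (μ (Iic y)).toReal = ν.real {z | z.1 ≤ y} := fun y => by
    rw [hμ, Measure.map_apply measurable_fst measurableSet_Iic]; rfl
  have hq := quant_le_iff μ ht
  set y0 := sInf {x : ℝ | t ≤ (μ (Iic x)).toReal}
  simp only [hF] at hq
  have hup : t ≤ ν.real {z | z.1 ≤ y0} := (hq y0).1 le_rfl
  have hlow : ∀ y < y0, ν.real {z | z.1 ≤ y} < t := fun y hy => by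
    by_contra h; exact absurd ((hq y).2 (not_lt.1 h)) (not_le.2 hy)
  set a := ν.real {z | z.1 < y0} with ha
  have hMlt : MeasurableSet {z : ℝ × ℝ | z.1 < y0} := measurableSet_lt (by fun_prop) (by fun_prop)
  have hMeq : MeasurableSet {z : ℝ × ℝ | z.1 = y0} := measurableSet_eq_fun (by fun_prop) (by fun_prop)
  have hat : a ≤ t := by
    have h := tendsto_measure_iUnion_atTop (μ := ν) (s := fun n : ℕ => {z : ℝ × ℝ | z.1 ≤ y0 - 1/((n:ℝ)+1)})
      (by
        intro n m hnm z hz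
        have : 1/((m:ℝ)+1) ≤ 1/((n:ℝ)+1) := Nat.one_div_le_one_div hnm
        simp only [mem_ofPred_eq] at hz ⊢; linarith)
    have h2 : (⋃ n : ℕ, {z : ℝ × ℝ | z.1 ≤ y0 - 1/((n:ℝ)+1)}) = {z | z.1 < y0} := by
      ext z
      simp only [mem_iUnion, mem_ofPred_eq]
      constructor
      · rintro ⟨n, hn⟩
        have : 0 < 1/((n:ℝ)+1) := Nat.one_div_pos_of_nat
        linarith
      · intro hz
        obtain ⟨n, hn⟩ := exists_nat_one_div_lt (sub_pos.2 hz)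
        exact ⟨n, by linarith⟩
    rw [h2] at h
    have h3 := (ENNReal.tendsto_toReal (measure_ne_top ν _)).comp h
    refine le_of_tendsto h3 (Eventually.of_forall fun n => ?_)
    have : 0 < 1/((n:ℝ)+1) := Nat.one_div_pos_of_nat
    exact (hlow _ (by linarith)).le
  set m := (ν.restrict {z | z.1 = y0}).map Prod.snd with hm
  have : IsFiniteMeasure m := by rw [hm]; infer_instance
  have hmA : ∀ B : Set ℝ, MeasurableSet B → m.real B = ν.real {z | z.1 = y0 ∧ z.2 ∈ B} := by
    intro B hB
    rw [hm, Measure.real, Measure.map_apply measurable_snd hB,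
      Measure.restrict_apply (measurable_snd hB), Measure.real]
    congr 2; ext z; simp [and_comm]
  have hm0 : ∀ x, m {x} = 0 := fun x => by
    rw [hm, Measure.map_apply measurable_snd (measurableSet_singleton x)]
    exact le_antisymm ((Measure.restrict_apply_le _ _).trans (hν x).le) bot_le
  have huniv : a + m.real univ = ν.real {z | z.1 ≤ y0} := by
    rw [hmA _ .univ, ha, ← measureReal_union]
    · congr 1; ext z; simp [le_iff_lt_or_eq]
    · rw [Set.disjoint_left]; rintro z h1 h2; simp at h1 h2; linarith
    · simpa using hMeq
  have hG : ∀ z, z.1 = y0 → ν.real (lexL z) = a + m.real (Iic z.2) := by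
    intro z hz
    rw [hmA _ measurableSet_Iic, ha, ← measureReal_union]
    · congr 1; ext z'; simp [lexL, hz]
    · rw [Set.disjoint_left]; rintro z h1 h2; simp at h1 h2; linarith
    · exact hMeq.inter (measurable_snd measurableSet_Iic)
  have hmono : Monotone fun u => m.real (Iic u) := fun u v huv =>
    measureReal_mono (Iic_subset_Iic.2 huv)
  obtain ⟨h1, h2⟩ := noatom_bounds m hm0 (s := t - a) (by linarith) (by linarith)
  have hM1 : MeasurableSet {u | m.real (Iic u) < t - a} := measurableSet_lt hmono.measurable measurable_const
  have hM2 : MeasurableSet {u | m.real (Iic u) ≤ t - a} := measurableSet_le hmono.measurable measurable_const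
  rw [hmA _ hM1] at h1
  rw [hmA _ hM2] at h2
  constructor
  · calc _ ≤ ν.real ({z | z.1 < y0} ∪ {z | z.1 = y0 ∧ z.2 ∈ {u | m.real (Iic u) < t - a}}) := by
          refine measureReal_mono fun z hz => ?_
          simp only [mem_ofPred_eq] at hz
          rcases lt_trichotomy z.1 y0 with h | h | h
          · exact Or.inl h
          · right; refine ⟨h, ?_⟩; rw [hG z h] at hz; simp only [mem_ofPred_eq]; linarith
          · exfalso
            have : ν.real {z | z.1 ≤ y0} ≤ ν.real (lexL z) := measureReal_mono fun z' hz' =>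
              Or.inl (lt_of_le_of_lt hz' h)
            linarith
      _ ≤ a + (t - a) := (measureReal_union_le _ _).trans (by linarith)
      _ = t := by ring
  · calc t = a + (t - a) := by ring
      _ ≤ ν.real {z | z.1 < y0} + ν.real {z | z.1 = y0 ∧ z.2 ∈ {u | m.real (Iic u) ≤ t - a}} := by
          linarith
      _ = ν.real ({z | z.1 < y0} ∪ {z | z.1 = y0 ∧ z.2 ∈ {u | m.real (Iic u) ≤ t - a}}) := by
          rw [measureReal_union]
          · rw [Set.disjoint_left]; rintro z h1 ⟨h2, -⟩; simp at h1; linarith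
          · exact hMeq.inter (measurable_snd hM2)
      _ ≤ _ := by
          refine measureReal_mono fun z hz => ?_
          rcases hz with h | ⟨h, h'⟩
          · have h3 : ν.real (lexL z) ≤ ν.real {z' | z'.1 ≤ z.1} := measureReal_mono fun z' hz' => by
              rcases hz' with h | h
              · exact h.le
              · exact h.1.le
            exact h3.trans (hlow _ h).le
          · simp only [mem_ofPred_eq] at h' ⊢
            rw [hG z h]; linarith

lemma unif_Iic (a : ℝ) : (volume.restrict (Ioo (0:ℝ) 1)) (Iic a) = ENNReal.ofReal (min a 1) := by
  rw [Measure.restrict_congr_set Ioo_ae_eq_Ioc, Measure.restrict_apply measurableSet_Iic,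
    inter_comm, Ioc_inter_Iic, Real.volume_Ioc, min_comm, sub_zero]

instance : IsProbabilityMeasure (volume.restrict (Ioo (0:ℝ) 1)) :=
  ⟨by rw [Measure.restrict_apply_univ]; simp⟩

lemma lex_unif (ν : Measure (ℝ × ℝ)) [IsProbabilityMeasure ν]
    (hν : ∀ u, ν (Prod.snd ⁻¹' {u}) = 0) :
    ν.map (fun z => ν.real (lexL z)) = volume.restrict (Ioo (0:ℝ) 1) := by
  have : IsProbabilityMeasure (ν.map (fun z => ν.real (lexL z))) :=
    Measure.isProbabilityMeasure_map (lexG_meas ν).aemeasurable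
  refine Measure.ext_of_Iic _ _ fun a => ?_
  rw [unif_Iic, Measure.map_apply (lexG_meas ν) measurableSet_Iic]
  have hup : a < 1 → ν.real {z | ν.real (lexL z) ≤ a} ≤ max a 0 := by
    intro h1
    refine le_of_forall_gt_imp_ge_of_dense fun b hb => ?_
    have hb0 : 0 < b := (le_max_right _ _).trans_lt hb
    have hba : a < b := (le_max_left _ _).trans_lt hb
    rcases lt_or_ge b 1 with hb1 | hb1
    · refine le_trans (measureReal_mono fun z hz => ?_) (lex_bounds ν hν ⟨hb0, hb1⟩).1
      exact lt_of_le_of_lt hz hba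
    · exact measureReal_le_one.trans hb1
  have hpre : ((fun z => ν.real (lexL z)) ⁻¹' Iic a) = {z | ν.real (lexL z) ≤ a} := rfl
  rw [hpre, ← ofReal_measureReal]
  rcases lt_or_ge a 1 with h1 | h1
  · rw [min_eq_left h1.le]
    rcases le_or_gt a 0 with h0 | h0
    · have := hup h1
      rw [max_eq_right h0] at this
      rw [le_antisymm this measureReal_nonneg, ENNReal.ofReal_of_nonpos h0]; simp
    · have := hup h1
      rw [max_eq_left h0.le] at this
      rw [le_antisymm this (lex_bounds ν hν ⟨h0, h1⟩).2]
  · rw [min_eq_right h1]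
    have : {z | ν.real (lexL z) ≤ a} = univ := by
      ext z; simp only [mem_ofPred_eq, mem_univ, iff_true]
      exact measureReal_le_one.trans h1
    rw [this]; simp

lemma stoch_dom {Ω : Type*} [MeasurableSpace Ω] (ν ν' : Measure Ω) [IsFiniteMeasure ν]
    [IsFiniteMeasure ν'] (hu : ν univ = ν' univ) (Y : Ω → ℝ) (hY : Measurable Y)
    (h1 : Integrable Y ν) (h2 : Integrable Y ν')
    (h : ∀ y, ν {ω | y < Y ω} ≤ ν' {ω | y < Y ω}) : ∫ ω, Y ω ∂ν ≤ ∫ ω, Y ω ∂ν' := by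
  have hc : ∀ y, ν' {ω | Y ω ≤ y} ≤ ν {ω | Y ω ≤ y} := by
    intro y
    have he : {ω | Y ω ≤ y} = {ω | y < Y ω}ᶜ := by ext; simp
    have hm : MeasurableSet {ω | y < Y ω} := measurableSet_lt measurable_const hY
    rw [he, measure_compl hm (measure_ne_top _ _), measure_compl hm (measure_ne_top _ _), hu]
    exact tsub_le_tsub_left (h y) _
  have hpos : ∀ m : Measure Ω, ∫⁻ ω, ENNReal.ofReal (Y ω) ∂m
      = ∫⁻ t in Ioi 0, m {ω | t < Y ω} := by
    intro m
    have := lintegral_eq_lintegral_meas_lt m (f := fun ω => max (Y ω) 0)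
      (Eventually.of_forall fun ω => le_max_right _ _) (by fun_prop)
    simp only [ENNReal.ofReal_max, ENNReal.ofReal_zero] at this
    simp only [zero_le, max_eq_left] at this
    rw [this]
    refine setLIntegral_congr_fun measurableSet_Ioi fun t ht => ?_
    have ht' : 0 < t := ht
    congr 1; ext ω; simp [not_lt.2 ht'.le]
  have hneg : ∀ m : Measure Ω, ∫⁻ ω, ENNReal.ofReal (-Y ω) ∂m
      = ∫⁻ t in Ioi 0, m {ω | Y ω ≤ -t} := by
    intro m
    have := lintegral_eq_lintegral_meas_le m (f := fun ω => max (-Y ω) 0)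
      (Eventually.of_forall fun ω => le_max_right _ _) (by fun_prop)
    simp only [ENNReal.ofReal_max, ENNReal.ofReal_zero] at this
    simp only [zero_le, max_eq_left] at this
    rw [this]
    refine setLIntegral_congr_fun measurableSet_Ioi fun t ht => ?_
    have ht' : 0 < t := ht
    congr 1; ext ω; simp [not_le.2 ht', le_neg]
  rw [integral_eq_lintegral_pos_part_sub_lintegral_neg_part h1,
    integral_eq_lintegral_pos_part_sub_lintegral_neg_part h2]
  refine sub_le_sub (ENNReal.toReal_mono h2.lintegral_lt_top.ne ?_)
    (ENNReal.toReal_mono h1.neg.lintegral_lt_top.ne ?_)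
  · rw [hpos, hpos]; exact lintegral_mono fun t => h t
  · rw [hneg, hneg]; exact lintegral_mono fun t => hc _

lemma hl_ineq {Ω : Type*} [MeasurableSpace Ω] (P : Measure Ω) [IsProbabilityMeasure P]
    (Z Z' Y : Ω → ℝ) (hZ : Measurable Z) (hZ' : Measurable Z') (hY : Measurable Y)
    (C : ℝ) (hC : ∀ ω, |Z ω| ≤ C) (hC' : ∀ ω, |Z' ω| ≤ C) (hYint : Integrable Y P)
    (hlaw : P.map Z = P.map Z')
    (h : ∀ x y, P ({ω | x < Z ω} ∩ {ω | y < Y ω}) ≤ P ({ω | x < Z' ω} ∩ {ω | y < Y ω})) :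
    ∫ ω, Z ω * Y ω ∂P ≤ ∫ ω, Z' ω * Y ω ∂P := by
  have hfin : ∀ Z : Ω → ℝ, Measurable Z → (∀ ω, |Z ω| ≤ C) →
      IsFiniteMeasure (P.withDensity fun ω => ENNReal.ofReal (Z ω + C)) := by
    intro Z hZ hC
    refine isFiniteMeasure_withDensity_ofReal ?_
    refine Integrable.hasFiniteIntegral ?_
    refine Integrable.of_bound (C := C + C) (by fun_prop) (Eventually.of_forall fun ω => ?_)
    have := abs_le.1 (hC ω)
    rw [Real.norm_eq_abs, abs_of_nonneg (by linarith)]; linarith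
  have hZY : ∀ Z : Ω → ℝ, Measurable Z → (∀ ω, |Z ω| ≤ C) → Integrable (fun ω => Z ω * Y ω) P := by
    intro Z hZ hC
    exact hYint.bdd_mul (c := C) hZ.aestronglyMeasurable (Eventually.of_forall hC)
  have hint : ∀ Z : Ω → ℝ, Measurable Z → (∀ ω, |Z ω| ≤ C) →
      Integrable Y (P.withDensity fun ω => ENNReal.ofReal (Z ω + C)) ∧
      ∫ ω, Y ω ∂(P.withDensity fun ω => ENNReal.ofReal (Z ω + C))
        = ∫ ω, Z ω * Y ω ∂P + C * ∫ ω, Y ω ∂P := by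
    intro Z hZ hC
    have hn : ∀ ω, 0 ≤ Z ω + C := fun ω => by have := abs_le.1 (hC ω); linarith
    have e : (fun ω => (ENNReal.ofReal (Z ω + C)).toReal • Y ω) =
        fun ω => Z ω * Y ω + C * Y ω := by
      funext ω; rw [ENNReal.toReal_ofReal (hn ω), smul_eq_mul]; ring
    constructor
    · rw [integrable_withDensity_iff_integrable_smul' (by fun_prop) (by simp)]
      rw [e]
      exact (hZY Z hZ hC).add (hYint.const_mul C)
    · rw [integral_withDensity_eq_integral_toReal_smul (by fun_prop) (by simp), e,
        integral_add (hZY Z hZ hC) (hYint.const_mul C), integral_const_mul]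
  have hset : ∀ Z : Ω → ℝ, Measurable Z → (∀ ω, |Z ω| ≤ C) → ∀ y,
      (P.withDensity fun ω => ENNReal.ofReal (Z ω + C)) {ω | y < Y ω} =
        ∫⁻ t in Ioi 0, P ({ω | t - C < Z ω} ∩ {ω | y < Y ω}) := by
    intro Z hZ hC y
    have hn : ∀ ω, 0 ≤ Z ω + C := fun ω => by have := abs_le.1 (hC ω); linarith
    have hm : MeasurableSet {ω | y < Y ω} := measurableSet_lt measurable_const hY
    rw [withDensity_apply _ hm, lintegral_eq_lintegral_meas_lt _ (Eventually.of_forall hn)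
      (by fun_prop)]
    refine lintegral_congr fun t => ?_
    rw [Measure.restrict_apply (measurableSet_lt measurable_const (by fun_prop))]
    congr 2; ext ω; simp [sub_lt_iff_lt_add]
  have := hfin Z hZ hC
  have := hfin Z' hZ' hC'
  have key := stoch_dom (P.withDensity fun ω => ENNReal.ofReal (Z ω + C))
    (P.withDensity fun ω => ENNReal.ofReal (Z' ω + C)) (by
      rw [withDensity_apply _ .univ, withDensity_apply _ .univ, Measure.restrict_univ]
      have hg : Measurable fun x : ℝ => ENNReal.ofReal (x + C) := by fun_prop
      rw [← lintegral_map hg hZ, ← lintegral_map hg hZ', hlaw]) Y hY (hint Z hZ hC).1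
      (hint Z' hZ' hC').1 (fun y => by
        rw [hset Z hZ hC, hset Z' hZ' hC']
        exact lintegral_mono fun t => h _ _)
  rw [(hint Z hZ hC).2, (hint Z' hZ' hC').2] at key
  linarith

def qt {N : ℕ} (K : Kernel (Fin N → ℝ) ℝ) (p : (Fin N → ℝ) × ℝ) : ℝ :=
  open Classical in if p.2 ∈ Ioo (0:ℝ) 1 then condVaR K p.1 p.2 else 0

lemma qt_le_iff {N : ℕ} (K : Kernel (Fin N → ℝ) ℝ) [IsMarkovKernel K] {w : Fin N → ℝ} {t : ℝ}
    (ht : t ∈ Ioo (0:ℝ) 1) (x : ℝ) : qt K (w, t) ≤ x ↔ t ≤ (K w (Iic x)).toReal := by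
  rw [qt, if_pos ht]
  exact quant_le_iff (K w) ht x

lemma F_meas {N : ℕ} (K : Kernel (Fin N → ℝ) ℝ) (x : ℝ) :
    Measurable fun w => (K w (Iic x)).toReal :=
  (K.measurable_coe measurableSet_Iic).ennreal_toReal

lemma qt_meas {N : ℕ} (K : Kernel (Fin N → ℝ) ℝ) [IsMarkovKernel K] : Measurable (qt K) := by
  refine measurable_of_Iic fun x => ?_
  have hI : MeasurableSet {p : (Fin N → ℝ) × ℝ | p.2 ∈ Ioo (0:ℝ) 1} :=
    measurable_snd measurableSet_Ioo
  have hF : MeasurableSet {p : (Fin N → ℝ) × ℝ | p.2 ≤ (K p.1 (Iic x)).toReal} :=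
    measurableSet_le measurable_snd ((F_meas K x).comp measurable_fst)
  have h0 : MeasurableSet {p : (Fin N → ℝ) × ℝ | (0:ℝ) ≤ x} := MeasurableSet.const _
  have : qt K ⁻¹' Iic x = ({p | p.2 ∈ Ioo (0:ℝ) 1} ∩ {p | p.2 ≤ (K p.1 (Iic x)).toReal}) ∪
      ({p | p.2 ∈ Ioo (0:ℝ) 1}ᶜ ∩ {p : (Fin N → ℝ) × ℝ | (0:ℝ) ≤ x}) := by
    ext p
    by_cases hp : p.2 ∈ Ioo (0:ℝ) 1
    · have := qt_le_iff K (w := p.1) hp x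
      simp only [mem_preimage, mem_Iic, mem_union, mem_inter_iff, mem_ofPred_eq, mem_compl_iff, hp,
        true_and, not_true_eq_false, false_and, or_false]
      exact this
    · simp only [mem_preimage, mem_Iic, mem_union, mem_inter_iff, mem_ofPred_eq, mem_compl_iff, hp,
        false_and, not_false_eq_true, true_and, false_or, qt, if_false]
  rw [this]
  exact (hI.inter hF).union (hI.compl.inter h0)

lemma law_Ioo {Ω : Type*} [MeasurableSpace Ω] {P : Measure Ω} [IsProbabilityMeasure P]
    {N : ℕ} {W : Ω → (Fin N → ℝ)} (hW : Measurable W) {T : Ω → ℝ} (hT : Measurable T)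
    (hlaw : P.map (fun ω => (W ω, T ω)) = (P.map W).prod (volume.restrict (Ioo (0:ℝ) 1))) :
    P.map T = volume.restrict (Ioo (0:ℝ) 1) ∧ ∀ᵐ ω ∂P, T ω ∈ Ioo (0:ℝ) 1 := by
  have : IsProbabilityMeasure (P.map W) := Measure.isProbabilityMeasure_map hW.aemeasurable
  have h : P.map T = volume.restrict (Ioo (0:ℝ) 1) := by
    have h := congrArg Measure.snd hlaw
    rw [Measure.snd_map_prodMk hW, Measure.snd_prod] at h
    exact h
  refine ⟨h, ?_⟩
  have h2 : ∀ᵐ t ∂(P.map T), t ∈ Ioo (0:ℝ) 1 := by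
    rw [h]; exact ae_restrict_mem measurableSet_Ioo
  exact ae_of_ae_map hT.aemeasurable h2

lemma law_qt {Ω : Type*} [MeasurableSpace Ω] {P : Measure Ω} [IsProbabilityMeasure P]
    {N : ℕ} {W : Ω → (Fin N → ℝ)} (hW : Measurable W) {T : Ω → ℝ} (hT : Measurable T)
    (hlaw : P.map (fun ω => (W ω, T ω)) = (P.map W).prod (volume.restrict (Ioo (0:ℝ) 1)))
    {X : Ω → ℝ} (hX : Measurable X) (K : Kernel (Fin N → ℝ) ℝ) (hK : IsCondDistrib P X W K) :
    P.map (fun ω => (qt K (W ω, T ω), W ω)) = P.map (fun ω => (X ω, W ω)) := by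
  have := hK.1
  have hq : Measurable fun ω => qt K (W ω, T ω) := (qt_meas K).comp (hW.prodMk hT)
  have : IsProbabilityMeasure (P.map (fun ω => (qt K (W ω, T ω), W ω))) :=
    Measure.isProbabilityMeasure_map (hq.prodMk hW).aemeasurable
  have hI := (law_Ioo hW hT hlaw).2
  refine Measure.ext_prod fun {B S} hB hS => ?_
  have hr : (P.restrict (W ⁻¹' S)).map (fun ω => qt K (W ω, T ω)) = (P.restrict (W ⁻¹' S)).map X := by
    refine Measure.ext_of_Iic _ _ fun x => ?_
    rw [Measure.map_apply hq measurableSet_Iic, Measure.map_apply hX measurableSet_Iic,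
      Measure.restrict_apply (hq measurableSet_Iic), Measure.restrict_apply (hX measurableSet_Iic)]
    have h1 := hK.2 (Iic x) measurableSet_Iic S hS
    refine Eq.trans ?_ h1.symm
    set D : Set ((Fin N → ℝ) × ℝ) := {p | p.2 ≤ (K p.1 (Iic x)).toReal} ∩ (Prod.fst ⁻¹' S)
    have hD : MeasurableSet D :=
      (measurableSet_le measurable_snd ((F_meas K x).comp measurable_fst)).inter
        (measurable_fst hS)
    have h2 : P ((fun ω => qt K (W ω, T ω)) ⁻¹' Iic x ∩ W ⁻¹' S) =
        P ((fun ω => (W ω, T ω)) ⁻¹' D) := by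
      refine measure_congr ?_
      filter_upwards [hI] with ω hω
      have := qt_le_iff K (w := W ω) hω x
      apply propext
      show (qt K (W ω, T ω) ≤ x ∧ W ω ∈ S) ↔ (T ω ≤ (K (W ω) (Iic x)).toReal ∧ W ω ∈ S)
      rw [this]
    rw [h2, ← Measure.map_apply (hW.prodMk hT) hD, hlaw, Measure.prod_apply hD,
      ← lintegral_indicator hS]
    refine lintegral_congr fun w => ?_
    by_cases hw : w ∈ S
    · rw [indicator_of_mem hw]
      have : Prod.mk w ⁻¹' D = Iic (K w (Iic x)).toReal := by
        ext t; simp [D, hw]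
      rw [this, unif_Iic, min_eq_left, ENNReal.ofReal_toReal (measure_ne_top _ _)]
      exact measureReal_le_one (μ := K w)
    · rw [indicator_of_notMem hw]
      have : Prod.mk w ⁻¹' D = ∅ := by
        ext t; simp [D, hw]
      rw [this, measure_empty]
  have h3 := congrArg (fun m => m B) hr
  simp only [Measure.map_apply hq hB, Measure.map_apply hX hB,
      Measure.restrict_apply (hq hB), Measure.restrict_apply (hX hB)] at h3
  rw [Measure.map_apply (hq.prodMk hW) (hB.prod hS), Measure.map_apply (hX.prodMk hW) (hB.prod hS)]
  exact h3

lemma condDistrib_compProd {Ω : Type*} [MeasurableSpace Ω] {P : Measure Ω} [IsProbabilityMeasure P]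
    {N : ℕ} {W : Ω → (Fin N → ℝ)} (hW : Measurable W)
    {X : Ω → ℝ} (hX : Measurable X) (K : Kernel (Fin N → ℝ) ℝ) (hK : IsCondDistrib P X W K) :
    P.map (fun ω => (W ω, X ω)) = P.map W ⊗ₘ K := by
  have := hK.1
  have : IsProbabilityMeasure (P.map W) := Measure.isProbabilityMeasure_map hW.aemeasurable
  have : IsProbabilityMeasure (P.map (fun ω => (W ω, X ω))) :=
    Measure.isProbabilityMeasure_map (hW.prodMk hX).aemeasurable
  refine Measure.ext_prod fun {S B} hS hB => ?_
  rw [Measure.compProd_apply_prod hS hB, ← hK.2 B hB S hS,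
    Measure.map_apply (hW.prodMk hX) (hS.prod hB), inter_comm]
  rfl

lemma exists_V {Ω : Type*} [MeasurableSpace Ω] (P : Measure Ω) [IsProbabilityMeasure P]
    {N : ℕ} (W : Ω → (Fin N → ℝ)) (hW : Measurable W)
    (hU : ∃ U : Ω → ℝ, Measurable U ∧ P.map U = volume.restrict (Ioo (0:ℝ) 1) ∧
      IndepFun U W P) (Y : Ω → ℝ) (hY : Measurable Y)
    (KY : Kernel (Fin N → ℝ) ℝ) (hKY : IsCondDistrib P Y W KY) :
    ∃ V : Ω → ℝ, Measurable V ∧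
      P.map (fun ω => (W ω, V ω)) = (P.map W).prod (volume.restrict (Ioo (0:ℝ) 1)) ∧
      ∀ᵐ ω ∂P, qt KY (W ω, V ω) = Y ω := by
  obtain ⟨U, hUm, hUlaw, hUW⟩ := hU
  have := hKY.1
  have hPW : IsProbabilityMeasure (P.map W) := Measure.isProbabilityMeasure_map hW.aemeasurable
  have hYU : Measurable fun ω => (Y ω, U ω) := hY.prodMk hUm
  set κ := condDistrib (fun ω => (Y ω, U ω)) W P with hκ
  have hcp : P.map W ⊗ₘ κ = P.map fun ω => (W ω, (Y ω, U ω)) :=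
    compProd_map_condDistrib hYU.aemeasurable
  -- marginals
  have hfst : ∀ᵐ w ∂(P.map W), (κ w).map Prod.fst = KY w := by
    have h1 := condDistrib_comp (μ := P) (mβ := MeasurableSpace.pi) W hYU.aemeasurable (measurable_fst (α := ℝ) (β := ℝ))
    have h2 := condDistrib_ae_eq_of_measure_eq_compProd (μ := P) W hY.aemeasurable
      (condDistrib_compProd hW hY KY hKY)
    filter_upwards [h1, h2] with w h1 h2
    rw [← Kernel.map_apply _ measurable_fst, ← h1, ← h2]
    rfl
  have hsnd : ∀ᵐ w ∂(P.map W), (κ w).map Prod.snd = volume.restrict (Ioo (0:ℝ) 1) := by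
    have h1 := condDistrib_comp (μ := P) (mβ := MeasurableSpace.pi) W hYU.aemeasurable (measurable_snd (α := ℝ) (β := ℝ))
    have h2 := condDistrib_ae_eq_of_measure_eq_compProd (μ := P) W hUm.aemeasurable
      (κ := Kernel.const _ (volume.restrict (Ioo (0:ℝ) 1))) (by
        rw [Measure.compProd_const, ← hUlaw]
        exact (indepFun_iff_map_prod_eq_prod_map_map hW.aemeasurable hUm.aemeasurable).1 hUW.symm)
    filter_upwards [h1, h2] with w h1 h2
    rw [← Kernel.map_apply _ measurable_snd, ← h1]
    exact h2
  have hunif : ∀ᵐ w ∂(P.map W), (κ w).map (fun z => (κ w).real (lexL z)) =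
      volume.restrict (Ioo (0:ℝ) 1) := by
    filter_upwards [hsnd] with w hw
    refine lex_unif _ fun u => ?_
    rw [← Measure.map_apply measurable_snd (measurableSet_singleton u), hw]
    simp
  -- the transform
  set G : (Fin N → ℝ) × (ℝ × ℝ) → ℝ := fun p => (κ p.1).real (lexL p.2) with hG
  have hGm : Measurable G := by
    have hs : MeasurableSet {q : ((Fin N → ℝ) × (ℝ × ℝ)) × (ℝ × ℝ) | q.2 ∈ lexL q.1.2} :=
      lexL_meas.preimage (f := fun q : ((Fin N → ℝ) × (ℝ × ℝ)) × (ℝ × ℝ) => (q.1.2, q.2))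
        (by fun_prop)
    have := Kernel.measurable_kernel_prodMk_left (κ := κ.comap Prod.fst measurable_fst) hs
    exact this.ennreal_toReal
  have hWYU : Measurable fun ω => (W ω, (Y ω, U ω)) := hW.prodMk hYU
  set V : Ω → ℝ := fun ω => G (W ω, (Y ω, U ω)) with hV
  have hVm : Measurable V := hGm.comp hWYU
  have hlaw : P.map (fun ω => (W ω, V ω)) = (P.map W).prod (volume.restrict (Ioo (0:ℝ) 1)) := by
    have : IsProbabilityMeasure (P.map (fun ω => (W ω, V ω))) :=
      Measure.isProbabilityMeasure_map (hW.prodMk hVm).aemeasurable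
    refine Measure.ext_prod fun {S B} hS hB => ?_
    rw [Measure.prod_prod, Measure.map_apply (hW.prodMk hVm) (hS.prod hB)]
    set D : Set ((Fin N → ℝ) × (ℝ × ℝ)) := Prod.fst ⁻¹' S ∩ G ⁻¹' B
    have hD : MeasurableSet D := (measurable_fst hS).inter (hGm hB)
    have e : (fun ω => (W ω, V ω)) ⁻¹' S ×ˢ B = (fun ω => (W ω, (Y ω, U ω))) ⁻¹' D := rfl
    rw [e, ← Measure.map_apply hWYU hD, ← hcp, Measure.compProd_apply hD]
    have : ∀ᵐ w ∂(P.map W), κ w (Prod.mk w ⁻¹' D) =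
        S.indicator (fun _ => (volume.restrict (Ioo (0:ℝ) 1)) B) w := by
      filter_upwards [hunif] with w hw
      by_cases hwS : w ∈ S
      · rw [indicator_of_mem hwS, ← hw, Measure.map_apply (lexG_meas (κ w)) hB]
        congr 1; ext z; simp [D, hwS, hG]
      · rw [indicator_of_notMem hwS]
        have : Prod.mk w ⁻¹' D = ∅ := by ext t; simp [D, hwS]
        rw [this, measure_empty]
    rw [lintegral_congr_ae this, lintegral_indicator hS, lintegral_const,
      Measure.restrict_apply_univ, mul_comm]
  refine ⟨V, hVm, hlaw, ?_⟩
  have hI := (law_Ioo hW hVm hlaw).2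
  have hqm : Measurable fun ω => qt KY (W ω, V ω) := (qt_meas KY).comp (hW.prodMk hVm)
  have hle : ∀ᵐ ω ∂P, qt KY (W ω, V ω) ≤ Y ω := by
    filter_upwards [hI, ae_of_ae_map hW.aemeasurable hfst] with ω h1 h2
    rw [qt_le_iff KY h1, ← h2, Measure.map_apply measurable_fst measurableSet_Iic]
    show (κ (W ω)).real (lexL (Y ω, U ω)) ≤ (κ (W ω)).real _
    refine measureReal_mono fun z hz => ?_
    rcases hz with h | h
    · exact h.le
    · exact h.1.le
  have hsame : P.map (fun ω => qt KY (W ω, V ω)) = P.map Y := by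
    have := congrArg Measure.fst (law_qt hW hVm hlaw hY KY hKY)
    rwa [Measure.fst_map_prodMk hW, Measure.fst_map_prodMk hW] at this
  have hrat : ∀ᵐ ω ∂P, ∀ r : ℚ, ¬ (qt KY (W ω, V ω) ≤ r ∧ (r:ℝ) < Y ω) := by
    rw [ae_all_iff]
    intro r
    have hA : MeasurableSet {ω | Y ω ≤ r} := hY measurableSet_Iic
    have hB : MeasurableSet {ω | qt KY (W ω, V ω) ≤ r} := hqm measurableSet_Iic
    have hAB : P {ω | Y ω ≤ r} = P {ω | qt KY (W ω, V ω) ≤ r} := by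
      have := congrArg (fun m => m (Iic (r:ℝ))) hsame
      simp only [Measure.map_apply hqm measurableSet_Iic, Measure.map_apply hY measurableSet_Iic] at this
      exact this.symm
    have hsub : {ω | Y ω ≤ r} ≤ᵐ[P] {ω | qt KY (W ω, V ω) ≤ r} := by
      filter_upwards [hle] with ω h1 h2
      exact h1.trans h2
    have heq := ae_eq_of_ae_subset_of_measure_ge hsub hAB.ge hA.nullMeasurableSet (measure_ne_top _ _)
    filter_upwards [heq] with ω hω hh
    have : Y ω ≤ r := (eq_iff_iff.1 hω).2 hh.1
    linarith [hh.2]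
  filter_upwards [hle, hrat] with ω h1 h2
  refine h1.antisymm (not_lt.1 fun h => ?_)
  obtain ⟨r, hr1, hr2⟩ := exists_rat_btwn h
  exact h2 r ⟨hr1.le, hr2⟩

lemma event_ineq {Ω : Type*} [MeasurableSpace Ω] (P : Measure Ω)
    {N : ℕ} (W : Ω → (Fin N → ℝ)) (hW : Measurable W) (A A' B : Set Ω)
    (S : Set (Fin N → ℝ)) (hS : MeasurableSet S)
    (hAA : P (A ∩ W ⁻¹' S) = P (A' ∩ W ⁻¹' S))
    (h1 : ∀ᵐ ω ∂P, W ω ∈ S → ω ∈ A' → ω ∈ B) (h2 : ∀ᵐ ω ∂P, W ω ∉ S → ω ∈ B → ω ∈ A') :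
    P (A ∩ B) ≤ P (A' ∩ B) := by
  rw [← measure_inter_add_sdiff (A ∩ B) (hW hS), ← measure_inter_add_sdiff (A' ∩ B) (hW hS)]
  refine add_le_add ?_ ?_
  · calc _ ≤ P (A ∩ W ⁻¹' S) := measure_mono fun ω h => ⟨h.1.1, h.2⟩
      _ = P (A' ∩ W ⁻¹' S) := hAA
      _ ≤ _ := by
        refine measure_mono_ae ?_
        filter_upwards [h1] with ω h hω
        exact ⟨⟨hω.1, h hω.2 hω.1⟩, hω.2⟩
  · refine measure_mono_ae ?_
    filter_upwards [h2] with ω h hω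
    exact ⟨⟨h hω.2 hω.1.2, hω.1.2⟩, hω.2⟩

lemma law_inter {Ω : Type*} [MeasurableSpace Ω] {P : Measure Ω}
    {N : ℕ} {W : Ω → (Fin N → ℝ)} (hW : Measurable W) {Z Z' : Ω → ℝ} (hZ : Measurable Z)
    (hZ' : Measurable Z') (h : (P.map fun ω => (Z ω, W ω)) = (P.map fun ω => (Z' ω, W ω)))
    {B : Set ℝ} (hB : MeasurableSet B) {S : Set (Fin N → ℝ)} (hS : MeasurableSet S) :
    P (Z ⁻¹' B ∩ W ⁻¹' S) = P (Z' ⁻¹' B ∩ W ⁻¹' S) := by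
  have := congrArg (fun m => m (B ×ˢ S)) h
  simp only [Measure.map_apply (hZ.prodMk hW) (hB.prod hS),
    Measure.map_apply (hZ'.prodMk hW) (hB.prod hS)] at this
  exact this

lemma exists_Z {Ω : Type*} [MeasurableSpace Ω] {P : Measure Ω} [IsProbabilityMeasure P]
    {N : ℕ} {W : Ω → (Fin N → ℝ)} (hW : Measurable W) {T : Ω → ℝ} (hT : Measurable T)
    (hlaw : P.map (fun ω => (W ω, T ω)) = (P.map W).prod (volume.restrict (Ioo (0:ℝ) 1)))
    {X : Ω → ℝ} (hX : BddRV X) (K : Kernel (Fin N → ℝ) ℝ) (hK : IsCondDistrib P X W K) :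
    ∃ Z : Ω → ℝ, BddRV Z ∧
      P.map (fun ω => (Z ω, W ω)) = P.map (fun ω => (X ω, W ω)) ∧
      ∀ᵐ ω ∂P, Z ω = qt K (W ω, T ω) := by
  have := hK.1
  obtain ⟨hXm, C, hC⟩ := hX
  have hq : Measurable fun ω => qt K (W ω, T ω) := (qt_meas K).comp (hW.prodMk hT)
  have hl := law_qt hW hT hlaw hXm K hK
  have hbd : ∀ᵐ ω ∂P, |qt K (W ω, T ω)| ≤ C := by
    have hs : P.map (fun ω => qt K (W ω, T ω)) = P.map X := by
      have := congrArg Measure.fst hl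
      rwa [Measure.fst_map_prodMk hW, Measure.fst_map_prodMk hW] at this
    have hm : MeasurableSet {x : ℝ | |x| ≤ C} := measurableSet_le (by fun_prop) (by fun_prop)
    have h1 : ∀ᵐ x ∂(P.map X), |x| ≤ C :=
      (ae_map_iff hXm.aemeasurable hm).2 (Eventually.of_forall hC)
    rw [← hs] at h1
    exact ae_of_ae_map hq.aemeasurable h1
  obtain ⟨ω0⟩ : Nonempty Ω := P.nonempty_of_neZero
  have hC0 : 0 ≤ C := (abs_nonneg _).trans (hC ω0)
  have hae : ∀ᵐ ω ∂P, max (-C) (min C (qt K (W ω, T ω))) = qt K (W ω, T ω) := by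
    filter_upwards [hbd] with ω h
    rw [abs_le] at h
    rw [min_eq_right h.2, max_eq_right h.1]
  refine ⟨fun ω => max (-C) (min C (qt K (W ω, T ω))), ⟨by fun_prop, C, fun ω => ?_⟩, ?_, hae⟩
  · rw [abs_le]
    exact ⟨le_max_left _ _, max_le (by linarith) (min_le_left _ _)⟩
  · rw [← hl]
    refine Measure.map_congr ?_
    filter_upwards [hae] with ω h
    rw [h]

lemma final_int {Ω : Type*} [MeasurableSpace Ω] {P : Measure Ω} [IsProbabilityMeasure P]
    {N : ℕ} {W : Ω → (Fin N → ℝ)} (hW : Measurable W) {V : Ω → ℝ} (hV : Measurable V)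
    (hlaw : P.map (fun ω => (W ω, V ω)) = (P.map W).prod (volume.restrict (Ioo (0:ℝ) 1)))
    (φ : ℝ → ℝ) (hφ : Measurable φ) (hφI : ∀ t ∈ Ioo (0:ℝ) 1, φ t ∈ Ioo (0:ℝ) 1)
    (KX KY : Kernel (Fin N → ℝ) ℝ) [IsMarkovKernel KX] [IsMarkovKernel KY]
    (Z Y : Ω → ℝ) (hZ : BddRV Z) (hYint : Integrable Y P)
    (hZe : ∀ᵐ ω ∂P, Z ω = qt KX (W ω, φ (V ω))) (hYe : ∀ᵐ ω ∂P, qt KY (W ω, V ω) = Y ω) :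
    ∫ ω, Z ω * Y ω ∂P =
      ∫ ω, (∫ t in Ioo (0:ℝ) 1, condVaR KX (W ω) (φ t) * condVaR KY (W ω) t) ∂P := by
  have hPW : IsProbabilityMeasure (P.map W) := Measure.isProbabilityMeasure_map hW.aemeasurable
  obtain ⟨hZm, C, hC⟩ := hZ
  set h : (Fin N → ℝ) × ℝ → ℝ := fun p => qt KX (p.1, φ p.2) * qt KY p with hh
  have hm : Measurable h :=
    ((qt_meas KX).comp (measurable_fst.prodMk (hφ.comp measurable_snd))).mul (qt_meas KY)
  have he : (fun ω => Z ω * Y ω) =ᵐ[P] fun ω => h (W ω, V ω) := by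
    filter_upwards [hZe, hYe] with ω h1 h2
    rw [hh]; simp only [h1, h2]
  have hint : Integrable (fun ω => Z ω * Y ω) P :=
    hYint.bdd_mul (c := C) hZm.aestronglyMeasurable (Eventually.of_forall hC)
  have hint2 : Integrable h ((P.map W).prod (volume.restrict (Ioo (0:ℝ) 1))) := by
    rw [← hlaw, integrable_map_measure hm.aestronglyMeasurable (hW.prodMk hV).aemeasurable]
    exact hint.congr he
  rw [integral_congr_ae he, ← integral_map (hW.prodMk hV).aemeasurable (f := h)
    hm.aestronglyMeasurable, hlaw, integral_prod h hint2,
    integral_map hW.aemeasurable hint2.integral_prod_left.aestronglyMeasurable]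
  refine integral_congr_ae (Eventually.of_forall fun ω => ?_)
  refine setIntegral_congr_fun measurableSet_Ioo fun t ht => ?_
  simp only [hh, qt, if_pos ht, if_pos (hφI t ht)]

lemma law_refl {Ω : Type*} [MeasurableSpace Ω] {P : Measure Ω} [IsProbabilityMeasure P]
    {N : ℕ} {W : Ω → (Fin N → ℝ)} (hW : Measurable W) {V : Ω → ℝ} (hV : Measurable V)
    (hlaw : P.map (fun ω => (W ω, V ω)) = (P.map W).prod (volume.restrict (Ioo (0:ℝ) 1))) :
    P.map (fun ω => (W ω, 1 - V ω)) = (P.map W).prod (volume.restrict (Ioo (0:ℝ) 1)) := by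
  have hPW : IsProbabilityMeasure (P.map W) := Measure.isProbabilityMeasure_map hW.aemeasurable
  have hu : (volume.restrict (Ioo (0:ℝ) 1)).map (fun t => 1 - t) = volume.restrict (Ioo (0:ℝ) 1) := by
    have h := ((Measure.measurePreserving_sub_left (volume : Measure ℝ) 1).restrict_preimage
      (s := Ioo (0:ℝ) 1) measurableSet_Ioo).map_eq
    have e : (fun t : ℝ => 1 - t) ⁻¹' Ioo (0:ℝ) 1 = Ioo 0 1 := by
      ext t; simp [and_comm]
    rwa [e] at h
  have h2 : (fun ω => (W ω, 1 - V ω)) = Prod.map id (fun t : ℝ => 1 - t) ∘ fun ω => (W ω, V ω) := rfl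
  rw [h2, ← Measure.map_map (by fun_prop) (by fun_prop), hlaw,
    ← Measure.map_prod_map _ _ measurable_id (by fun_prop), hu, Measure.map_id]

/-- **Lemma (conditional Hardy–Littlewood inequality).** -/
theorem stmt12 {Ω : Type*} [MeasurableSpace Ω] (P : Measure Ω) [IsProbabilityMeasure P]
    (hatomless : Atomless P) {N : ℕ} (hN : 1 ≤ N)
    (W : Ω → (Fin N → ℝ)) (hW : Measurable W)
    (hU : ∃ U : Ω → ℝ, Measurable U ∧ P.map U = volume.restrict (Ioo (0:ℝ) 1) ∧
      IndepFun U W P)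
    (X : Ω → ℝ) (hX : BddRV X) (Y : Ω → ℝ) (hY : Measurable Y) (hYint : Integrable Y P)
    (KX KY : Kernel (Fin N → ℝ) ℝ)
    (hKX : IsCondDistrib P X W KX) (hKY : IsCondDistrib P Y W KY) :
    sSup {r : ℝ | ∃ Z : Ω → ℝ, BddRV Z ∧
        (P.map fun ω => (Z ω, W ω)) = (P.map fun ω => (X ω, W ω)) ∧
        r = ∫ ω, Z ω * Y ω ∂P} =
      ∫ ω, (∫ t in Ioo (0:ℝ) 1, condVaR KX (W ω) t * condVaR KY (W ω) t) ∂P ∧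
    sInf {r : ℝ | ∃ Z : Ω → ℝ, BddRV Z ∧
        (P.map fun ω => (Z ω, W ω)) = (P.map fun ω => (X ω, W ω)) ∧
        r = ∫ ω, Z ω * Y ω ∂P} =
      ∫ ω, (∫ t in Ioo (0:ℝ) 1, condVaR KX (W ω) (1 - t) * condVaR KY (W ω) t) ∂P := by
  have := hKX.1
  have := hKY.1
  obtain ⟨V, hV, hlaw, hYe⟩ := exists_V P W hW hU Y hY KY hKY
  have hVI := (law_Ioo hW hV hlaw).2
  have hlaw' := law_refl hW hV hlaw
  have hV'm : Measurable fun ω => 1 - V ω := by fun_prop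
  obtain ⟨Z1, hZ1, hZ1l, hZ1e⟩ := exists_Z hW hV hlaw hX KX hKX
  obtain ⟨Z2, hZ2, hZ2l, hZ2e⟩ := exists_Z hW hV'm hlaw' hX KX hKX
  have hYV : ∀ y : ℝ, ∀ᵐ ω ∂P, y < Y ω ↔ (KY (W ω) (Iic y)).toReal < V ω := by
    intro y
    filter_upwards [hYe, hVI] with ω h1 h2
    rw [← not_le, ← not_le, ← h1, qt_le_iff KY h2]
  have hmarg : ∀ {A B : Ω → ℝ}, (P.map fun ω => (A ω, W ω)) = (P.map fun ω => (B ω, W ω)) →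
      P.map A = P.map B := by
    intro A B h
    have := congrArg Measure.fst h
    rwa [Measure.fst_map_prodMk hW, Measure.fst_map_prodMk hW] at this
  constructor
  · rw [← final_int hW hV hlaw (fun t => t) measurable_id (fun t ht => ht) KX KY Z1 Y hZ1 hYint hZ1e hYe]
    refine IsGreatest.csSup_eq ⟨⟨Z1, hZ1, hZ1l, rfl⟩, ?_⟩
    rintro r ⟨Z, hZ, hZl, rfl⟩
    have hl := hZl.trans hZ1l.symm
    obtain ⟨hZm, C, hC⟩ := hZ
    obtain ⟨hZ1m, C1, hC1⟩ := hZ1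
    refine hl_ineq P Z Z1 Y hZm hZ1m hY (max C C1) (fun ω => (hC ω).trans (le_max_left _ _))
      (fun ω => (hC1 ω).trans (le_max_right _ _)) hYint (hmarg hl) fun x y => ?_
    have hZV : ∀ᵐ ω ∂P, x < Z1 ω ↔ (KX (W ω) (Iic x)).toReal < V ω := by
      filter_upwards [hZ1e, hVI] with ω h1 h2
      rw [← not_le, ← not_le, h1, qt_le_iff KX h2]
    have hS : MeasurableSet {w | (KY w (Iic y)).toReal ≤ (KX w (Iic x)).toReal} :=
      measurableSet_le (F_meas KY y) (F_meas KX x)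
    refine event_ineq P W hW _ _ _ _ hS (law_inter hW hZm hZ1m hl measurableSet_Ioi hS) ?_ ?_
    · filter_upwards [hZV, hYV y] with ω h1 h2 h3 h4
      exact h2.2 (lt_of_le_of_lt h3 (h1.1 h4))
    · filter_upwards [hZV, hYV y] with ω h1 h2 h3 h4
      exact h1.2 (lt_trans (not_le.1 h3) (h2.1 h4))
  · rw [← final_int hW hV hlaw (fun t => 1 - t) (by fun_prop)
      (fun t ht => ⟨by linarith [ht.2], by linarith [ht.1]⟩) KX KY Z2 Y hZ2 hYint hZ2e hYe]
    refine IsLeast.csInf_eq ⟨⟨Z2, hZ2, hZ2l, rfl⟩, ?_⟩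
    rintro r ⟨Z, hZ, hZl, rfl⟩
    have hl := hZl.trans hZ2l.symm
    obtain ⟨hZm, C, hC⟩ := hZ
    obtain ⟨hZ2m, C2, hC2⟩ := hZ2
    refine hl_ineq P Z2 Z Y hZ2m hZm hY (max C C2) (fun ω => (hC2 ω).trans (le_max_right _ _))
      (fun ω => (hC ω).trans (le_max_left _ _)) hYint (hmarg hl.symm) fun x y => ?_
    have hZV : ∀ᵐ ω ∂P, Z2 ω ≤ x ↔ 1 - V ω ≤ (KX (W ω) (Iic x)).toReal := by
      filter_upwards [hZ2e, hVI] with ω h1 h2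
      rw [h1, qt_le_iff KX ⟨by linarith [h2.2], by linarith [h2.1]⟩]
    have hS : MeasurableSet {w | (KY w (Iic y)).toReal < 1 - (KX w (Iic x)).toReal} :=
      measurableSet_lt (F_meas KY y) ((F_meas KX x).const_sub 1)
    have key : P ({ω | Z ω ≤ x} ∩ {ω | y < Y ω}) ≤ P ({ω | Z2 ω ≤ x} ∩ {ω | y < Y ω}) := by
      refine event_ineq P W hW _ _ _ _ hS (law_inter hW hZm hZ2m hl measurableSet_Iic hS) ?_ ?_
      · filter_upwards [hZV, hYV y] with ω h1 h2 h3 h4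
        have h5 := h1.1 h4
        have h6 : (KY (W ω) (Iic y)).toReal < 1 - (KX (W ω) (Iic x)).toReal := h3
        exact h2.2 (by linarith)
      · filter_upwards [hZV, hYV y] with ω h1 h2 h3 h4
        have h5 := h2.1 h4
        have h6 : ¬ ((KY (W ω) (Iic y)).toReal < 1 - (KX (W ω) (Iic x)).toReal) := h3
        exact h1.2 (by linarith [not_lt.1 h6])
    have hcompl : ∀ A : Ω → ℝ, Measurable A → P ({ω | x < A ω} ∩ {ω | y < Y ω}) =
        P {ω | y < Y ω} - P ({ω | A ω ≤ x} ∩ {ω | y < Y ω}) := by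
      intro A hA
      have hm : MeasurableSet {ω | A ω ≤ x} := hA measurableSet_Iic
      have h1 := measure_inter_add_sdiff (μ := P) {ω | y < Y ω} hm
      have h2 : {ω | y < Y ω} \ {ω | A ω ≤ x} = {ω | x < A ω} ∩ {ω | y < Y ω} := by
        ext ω; simp [and_comm]
      rw [h2, inter_comm {ω | y < Y ω}] at h1
      rw [← h1, ENNReal.add_sub_cancel_left (measure_ne_top _ _)]
    rw [hcompl Z hZm, hcompl Z2 hZ2m]
    exact tsub_le_tsub_left key _
end
end

section
/- Let Y be an integrable random variable, W : Ω → ℝ^N a Borel-measurable random vector, and K a Markov kernel from ℝ^N to ℝ with K(·, W) a version of the conditional distribution ℙ(Y ∈ · | W), such that for ℙ-almost every ω the conditional distribution function x ↦ F_{Y|W}(x)(ω) := K((−∞, x], W(ω)) is continuous on ℝ. Define V = F_{Y|W}(Y). Then: (i) the conditional distribution of V given W is almost surely the uniform distribution on (0,1), i.e., for every t ∈ (0,1), ℙ(V ≤ t | W) = t a.s.; and (ii) Y = VaR_V(Y | W) almost surely, where VaR_u(Y | W) = inf{x ∈ ℝ : K((−∞, x], W) ≥ u}. -/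
open MeasureTheory ProbabilityTheory Set Filter

noncomputable section

theorem aux_upper (ν : Measure ℝ) [IsProbabilityMeasure ν]
    (hc : Continuous fun x : ℝ => (ν (Iic x)).toReal) (t : ℝ) (h0 : 0 ≤ t) :
    ν {x | (ν (Iic x)).toReal ≤ t} ≤ ENNReal.ofReal t := by
  have hF : (fun x : ℝ => (ν (Iic x)).toReal) = cdf ν := by
    ext x; rw [cdf_eq_real]; rfl
  have hmono : Monotone fun x : ℝ => (ν (Iic x)).toReal := by rw [hF]; exact monotone_cdf ν
  have hb : Tendsto (fun x : ℝ => (ν (Iic x)).toReal) atBot (nhds 0) := by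
    rw [hF]; exact tendsto_cdf_atBot ν
  have ht : Tendsto (fun x : ℝ => (ν (Iic x)).toReal) atTop (nhds 1) := by
    rw [hF]; exact tendsto_cdf_atTop ν
  rcases le_or_gt 1 t with h1 | h1
  · exact prob_le_one.trans (by simpa using ENNReal.ofReal_le_ofReal h1)
  apply ge_of_tendsto (x := nhdsWithin t (Ioi t)) (f := fun s => ENNReal.ofReal s)
  · exact (ENNReal.continuous_ofReal.tendsto t).mono_left nhdsWithin_le_nhds
  · filter_upwards [Ioo_mem_nhdsGT h1] with s hs
    obtain ⟨y, hy⟩ := mem_range_of_exists_le_of_exists_ge hc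
      (((hb.eventually (gt_mem_nhds (h0.trans_lt hs.1))).exists).imp fun _ h => le_of_lt h)
      (((ht.eventually (lt_mem_nhds hs.2)).exists).imp fun _ h => le_of_lt h)
    have hy' : (ν (Iic y)).toReal = s := hy
    rw [← hy', ENNReal.ofReal_toReal (measure_ne_top _ _)]
    apply measure_mono
    intro x hx
    by_contra hxy
    have := hmono (not_le.1 hxy).le
    have hx' : (ν (Iic x)).toReal ≤ t := hx
    simp only at this
    linarith [hs.1]

theorem aux_eq (ν : Measure ℝ) [IsProbabilityMeasure ν]
    (hc : Continuous fun x : ℝ => (ν (Iic x)).toReal) (t : ℝ) (h : t ∈ Ioo (0:ℝ) 1) :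
    ν {x | (ν (Iic x)).toReal ≤ t} = ENNReal.ofReal t := by
  have hF : (fun x : ℝ => (ν (Iic x)).toReal) = cdf ν := by
    ext x; rw [cdf_eq_real]; rfl
  have hmono : Monotone fun x : ℝ => (ν (Iic x)).toReal := by rw [hF]; exact monotone_cdf ν
  have hb : Tendsto (fun x : ℝ => (ν (Iic x)).toReal) atBot (nhds 0) := by
    rw [hF]; exact tendsto_cdf_atBot ν
  have ht : Tendsto (fun x : ℝ => (ν (Iic x)).toReal) atTop (nhds 1) := by
    rw [hF]; exact tendsto_cdf_atTop ν
  refine le_antisymm (aux_upper ν hc t h.1.le) ?_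
  obtain ⟨y, hy⟩ := mem_range_of_exists_le_of_exists_ge hc
      (((hb.eventually (gt_mem_nhds h.1)).exists).imp fun _ h => le_of_lt h)
      (((ht.eventually (lt_mem_nhds h.2)).exists).imp fun _ h => le_of_lt h)
  have hy' : (ν (Iic y)).toReal = t := hy
  rw [← hy', ENNReal.ofReal_toReal (measure_ne_top _ _)]
  exact measure_mono fun x hx => hmono hx

theorem aux_null (ν : Measure ℝ) [IsProbabilityMeasure ν]
    (hc : Continuous fun x : ℝ => (ν (Iic x)).toReal) (q : ℝ) :
    ν {x | q < x ∧ (ν (Iic x)).toReal ≤ (ν (Iic q)).toReal} = 0 := by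
  have h := aux_upper ν hc (ν (Iic q)).toReal ENNReal.toReal_nonneg
  rw [ENNReal.ofReal_toReal (measure_ne_top _ _)] at h
  have hd : Disjoint {x | q < x ∧ (ν (Iic x)).toReal ≤ (ν (Iic q)).toReal} (Iic q) := by
    rw [Set.disjoint_left]
    rintro x ⟨hx, -⟩ hx'
    exact absurd hx' (not_le.2 hx)
  have h2 := measure_union hd (measurableSet_Iic (a := q)) (μ := ν)
  have h3 : ν ({x | q < x ∧ (ν (Iic x)).toReal ≤ (ν (Iic q)).toReal} ∪ Iic q) ≤ ν (Iic q) := by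
    refine (measure_mono ?_).trans h
    rintro x (hx | hx)
    · exact hx.2
    · exact ENNReal.toReal_mono (measure_ne_top _ _) (measure_mono (Iic_subset_Iic.2 hx))
  rw [h2] at h3
  by_contra hne
  have := ENNReal.lt_add_right (measure_ne_top ν (Iic q)) hne
  rw [add_comm] at h3
  exact absurd h3 (not_le.2 this)

theorem aux_meas {N : ℕ} (K : Kernel (Fin N → ℝ) ℝ) [IsMarkovKernel K] :
    Measurable fun p : (Fin N → ℝ) × ℝ => (K p.1 (Iic p.2)).toReal := by
  have hs : MeasurableSet {r : ((Fin N → ℝ) × ℝ) × ℝ | r.2 ≤ r.1.2} :=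
    measurableSet_le (by fun_prop) (by fun_prop)
  have := Kernel.measurable_kernel_prodMk_left (κ := K.comap Prod.fst measurable_fst
    (γ := (Fin N → ℝ) × ℝ)) hs
  exact this.ennreal_toReal

theorem aux_joint {Ω : Type*} [MeasurableSpace Ω] (P : Measure Ω) [IsProbabilityMeasure P]
    {N : ℕ} (Y : Ω → ℝ) (hYm : Measurable Y)
    (W : Ω → (Fin N → ℝ)) (hW : Measurable W)
    (K : Kernel (Fin N → ℝ) ℝ) (hK : IsCondDistrib P Y W K)
    (A : Set ((Fin N → ℝ) × ℝ)) (hA : MeasurableSet A) :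
    P {ω | (W ω, Y ω) ∈ A} = ∫⁻ ω, K (W ω) {x | (W ω, x) ∈ A} ∂P := by
  have := hK.1
  have : IsProbabilityMeasure (P.map W) := Measure.isProbabilityMeasure_map hW.aemeasurable
  have hm : P.map (fun ω => (W ω, Y ω)) = (P.map W).compProd K := by
    have : IsProbabilityMeasure (P.map (fun ω => (W ω, Y ω))) :=
      Measure.isProbabilityMeasure_map (hW.prodMk hYm).aemeasurable
    refine Measure.ext_prod_iff.2 fun {s t} hs ht => ?_
    rw [Measure.map_apply (hW.prodMk hYm) (hs.prod ht), Measure.compProd_apply_prod hs ht,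
      ← hK.2 t ht s hs]
    congr 1
    ext ω
    simp [and_comm]
  have h1 : P {ω | (W ω, Y ω) ∈ A} = P.map (fun ω => (W ω, Y ω)) A :=
    (Measure.map_apply (hW.prodMk hYm) hA).symm
  rw [h1, hm, Measure.compProd_apply hA, lintegral_map (Kernel.measurable_kernel_prodMk_left hA) hW]
  rfl

/-- **Lemma (conditional probability-integral transform).** If the conditional CDF of
`Y` given `W` is a.s. continuous, then `V = F_{Y|W}(Y)` is conditionally `U(0,1)` given
`W`, and `Y = VaR_V(Y|W)` a.s. -/
theorem stmt19 {Ω : Type*} [MeasurableSpace Ω] (P : Measure Ω) [IsProbabilityMeasure P]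
    {N : ℕ} (Y : Ω → ℝ) (hYm : Measurable Y) (hYint : Integrable Y P)
    (W : Ω → (Fin N → ℝ)) (hW : Measurable W)
    (K : Kernel (Fin N → ℝ) ℝ) (hK : IsCondDistrib P Y W K)
    (hcont : ∀ᵐ ω ∂P, Continuous fun x : ℝ => (K (W ω) (Iic x)).toReal) :
    -- (i) conditional uniformity of `V = F_{Y|W}(Y)`
    (∀ t ∈ Ioo (0:ℝ) 1, ∀ S : Set (Fin N → ℝ), MeasurableSet S →
      P ({ω | (K (W ω) (Iic (Y ω))).toReal ≤ t} ∩ W ⁻¹' S) =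
        ENNReal.ofReal t * P (W ⁻¹' S)) ∧
    -- (ii) `Y = VaR_V(Y | W)` a.s.
    (∀ᵐ ω ∂P, Y ω =
      sInf {x : ℝ | (K (W ω) (Iic (Y ω))).toReal ≤ (K (W ω) (Iic x)).toReal}) := by
  have := hK.1
  have hm := aux_meas K
  refine ⟨fun t ht S hS => ?_, ?_⟩
  · have hA : MeasurableSet {p : (Fin N → ℝ) × ℝ | (K p.1 (Iic p.2)).toReal ≤ t ∧ p.1 ∈ S} :=
      (measurableSet_le hm measurable_const).inter (measurable_fst hS)
    have h := aux_joint P Y hYm W hW K hK _ hA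
    refine (Eq.trans ?_ h).trans ?_
    · rfl
    · have : ∀ᵐ ω ∂P, K (W ω) {x | (W ω, x) ∈
          {p : (Fin N → ℝ) × ℝ | (K p.1 (Iic p.2)).toReal ≤ t ∧ p.1 ∈ S}} =
          (W ⁻¹' S).indicator (fun _ => ENNReal.ofReal t) ω := by
        filter_upwards [hcont] with ω hω
        by_cases hS' : W ω ∈ S
        · rw [Set.indicator_of_mem (by exact hS'), ← aux_eq (K (W ω)) hω t ht]
          simp [hS']
        · rw [Set.indicator_of_notMem (by exact hS')]
          simp [hS']
      rw [lintegral_congr_ae this, lintegral_indicator (hW hS), setLIntegral_const]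
  · have hq : ∀ q : ℚ, ∀ᵐ ω ∂P, ¬ ((q : ℝ) < Y ω ∧
        (K (W ω) (Iic (Y ω))).toReal ≤ (K (W ω) (Iic (q : ℝ))).toReal) := by
      intro q
      have hA : MeasurableSet {p : (Fin N → ℝ) × ℝ | (q : ℝ) < p.2 ∧
          (K p.1 (Iic p.2)).toReal ≤ (K p.1 (Iic (q : ℝ))).toReal} :=
        (measurableSet_lt measurable_const measurable_snd).inter
          (measurableSet_le hm (hm.comp (measurable_fst.prodMk measurable_const)))
      have h := aux_joint P Y hYm W hW K hK _ hA
      rw [lintegral_congr_ae (g := fun _ => 0)] at h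
      · rw [lintegral_zero] at h
        rw [ae_iff]
        simpa using h
      · filter_upwards [hcont] with ω hω
        exact aux_null (K (W ω)) hω q
    filter_upwards [ae_all_iff.2 hq] with ω hω
    symm
    apply IsLeast.csInf_eq
    refine ⟨le_refl (K (W ω) (Iic (Y ω))).toReal, fun y hy => ?_⟩
    by_contra hlt
    obtain ⟨q, hq1, hq2⟩ := exists_rat_btwn (not_le.1 hlt)
    exact hω q ⟨hq2, le_trans hy (ENNReal.toReal_mono (measure_ne_top _ _)
      (measure_mono (Iic_subset_Iic.2 hq1.le)))⟩
end
end
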